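/- There exists an absolute constant C > 0 with the following property. Let X_1,…,X_n be i.i.d. random vectors in ℝ^d with mean zero, let n = m_1 + m_2, and suppose that 0 < E[f_mean(X)^2 | X₂] < ∞ almost surely, where X is an independent copy of X_1 and X₂ = (X_{m_1+1},…,X_n). Then, almost surely, sup_{z ∈ ℝ} | P(T_mean ≤ z | X₂) − Φ(z) | ≤ C · E[|f_mean(X)|^3 | X₂] / ( (E[f_mean(X)^2 | X₂])^{3/2} · √m_1 ). -/

import Mathlib

/-!
Statement 0: Conditional Berry–Esseen bound for the studentized cross mean statistic
`T_mean` (Lemma 1 of Kim & Ramdas, "Dimension-agnostic inference using cross U-statistics").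

Conditionally on the second half of the sample `𝒳₂`, the function
`f_mean(x) = μ̂₂ᵀ x` is a fixed linear functional `x ↦ vᵀx` (with `v = μ̂₂`), and the
first-half observations are i.i.d. from `P`.  The almost-sure conditional statement is
therefore formalized by quantifying over every vector `v` for which the conditional
second moment is strictly positive (and the third moment finite): there is an absolute
constant `C > 0` such that for every dimension `d`, every `m₁ ≥ 1`, every mean-zero
distribution `P` on `ℝ^d` and every such `v`,
`sup_z |P(T_mean ≤ z ∣ 𝒳₂) − Φ(z)| ≤ C·E[|vᵀX|³]/((E[(vᵀX)²])^{3/2}·√m₁)`.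
-/

open MeasureTheory ProbabilityTheory Filter

noncomputable section

/-- Euclidean dot product on `Fin d → ℝ`. -/
def dot {d : ℕ} (x y : Fin d → ℝ) : ℝ := ∑ i, x i * y i

/-- Studentized statistic `√m · ȳ / sqrt(m⁻¹ ∑ (yᵢ − ȳ)²)` of a sample of reals. -/
def studentized (m : ℕ) (y : Fin m → ℝ) : ℝ :=
  Real.sqrt m * ((∑ i, y i) / m) /
    Real.sqrt ((∑ i, (y i - (∑ j, y j) / m) ^ 2) / m)

/-- Standard normal cumulative distribution function. -/
def Φ (z : ℝ) : ℝ := ∫ t in Set.Iic z, Real.exp (-t ^ 2 / 2) / Real.sqrt (2 * Real.pi)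

/-! ### Truncated inverse square root -/

def clp (s : ℝ) : ℝ := max (1/4) (min 4 s)

def kap (s : ℝ) : ℝ := (Real.sqrt (clp s))⁻¹

lemma clp_ge (s : ℝ) : 1/4 ≤ clp s := le_max_left _ _
lemma clp_le (s : ℝ) : clp s ≤ 4 := max_le (by norm_num) (min_le_left _ _)

lemma sqrt_clp_ge (s : ℝ) : 1/2 ≤ Real.sqrt (clp s) := by
  apply Real.le_sqrt_of_sq_le
  have := clp_ge s
  linarith

lemma sqrt_clp_le (s : ℝ) : Real.sqrt (clp s) ≤ 2 := by
  apply Real.sqrt_le_iff.2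
  have := clp_le s
  constructor <;> linarith

lemma kap_pos (s : ℝ) : 0 < kap s := by
  have := sqrt_clp_ge s
  unfold kap
  positivity

lemma kap_le (s : ℝ) : kap s ≤ 2 := by
  have := sqrt_clp_ge s
  unfold kap
  rw [inv_le_comm₀ (by linarith) (by norm_num)]
  linarith

lemma kap_ge (s : ℝ) : 1/2 ≤ kap s := by
  have := sqrt_clp_ge s
  have := sqrt_clp_le s
  unfold kap
  rw [le_inv_comm₀ (by norm_num) (by linarith)]
  linarith

lemma kap_sq (s : ℝ) : kap s ^ 2 = (clp s)⁻¹ := by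
  have := clp_ge s
  unfold kap
  rw [inv_pow, Real.sq_sqrt (by linarith)]

lemma clp_lip (s t : ℝ) : |clp s - clp t| ≤ |s - t| := by
  unfold clp
  have h1 := abs_max_sub_max_le_max (1/4) (min 4 s) (1/4) (min 4 t)
  have h2 := abs_min_sub_min_le_max 4 s 4 t
  simp at h1 h2
  linarith

lemma kap_lip (s t : ℝ) : |kap s - kap t| ≤ 4 * |s - t| := by
  have hs := sqrt_clp_ge s
  have ht := sqrt_clp_ge t
  have h1 := Real.sq_sqrt (show 0 ≤ clp s by linarith [clp_ge s])
  have h2 := Real.sq_sqrt (show 0 ≤ clp t by linarith [clp_ge t])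
  have h3 := clp_lip s t
  unfold kap
  set x := Real.sqrt (clp s)
  set y := Real.sqrt (clp t)
  have e : x⁻¹ - y⁻¹ = (y - x) * (x⁻¹ * y⁻¹) := by field_simp
  have hx : x⁻¹ ≤ 2 := by rw [inv_le_comm₀ (by linarith) (by norm_num)]; linarith
  have hy : y⁻¹ ≤ 2 := by rw [inv_le_comm₀ (by linarith) (by norm_num)]; linarith
  have hx0 : 0 < x⁻¹ := by positivity
  have hy0 : 0 < y⁻¹ := by positivity
  have hxy : x⁻¹ * y⁻¹ ≤ 4 := by nlinarith
  have h4 : |y - x| ≤ |s - t| := by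
    refine le_trans ?_ h3
    rw [← h1, ← h2, sq_sub_sq, abs_mul, abs_sub_comm x y, abs_of_pos (show 0 < x + y by linarith)]
    nlinarith [abs_nonneg (y - x)]
  rw [e, abs_mul, abs_of_pos (show 0 < x⁻¹ * y⁻¹ by positivity)]
  calc |y - x| * (x⁻¹ * y⁻¹) ≤ |s - t| * 4 := by gcongr
    _ = _ := by ring

lemma measurable_clp : Measurable clp := by unfold clp; fun_prop
lemma measurable_kap : Measurable kap := by
  unfold kap; exact (measurable_clp.sqrt).inv

/-- The two-variable function used in Stein's identity. -/
def gg (f : ℝ → ℝ) (w s : ℝ) : ℝ := f (w * kap s) * kap s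

lemma gg_bound {f : ℝ → ℝ} {b : ℝ} (hb : ∀ x, |f x| ≤ b) (w s : ℝ) : |gg f w s| ≤ 2 * b := by
  unfold gg
  rw [abs_mul, abs_of_pos (kap_pos s)]
  have := kap_le s
  have := kap_pos s
  nlinarith [hb (w * kap s), abs_nonneg (f (w * kap s))]

lemma gg_diff {f : ℝ → ℝ} {b K : ℝ} (hK : 0 ≤ K) (hb : ∀ x, |f x| ≤ b)
    (hl : ∀ x y, |f x - f y| ≤ K * |x - y|) (w s t : ℝ) :
    |gg f w s - gg f w t| ≤ 4 * |s - t| * (2 * K * |w| + b) := by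
  unfold gg
  have e : f (w * kap s) * kap s - f (w * kap t) * kap t =
    (f (w * kap s) - f (w * kap t)) * kap s + f (w * kap t) * (kap s - kap t) := by ring
  have h1 := hl (w * kap s) (w * kap t)
  have h2 := hb (w * kap t)
  have h3 := kap_lip s t
  rw [← mul_sub, abs_mul] at h1
  rw [e]
  refine (abs_add_le _ _).trans ?_
  rw [abs_mul, abs_mul, abs_of_pos (kap_pos s)]
  have hb0 : 0 ≤ b := (abs_nonneg _).trans h2
  calc _ ≤ (K * (|w| * |kap s - kap t|)) * 2 + b * |kap s - kap t| := by
        have hk0 := (kap_pos s).le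
        have hk2 := kap_le s
        gcongr
    _ = |kap s - kap t| * (2 * K * |w| + b) := by ring
    _ ≤ _ := by gcongr

lemma measurable_gg {f : ℝ → ℝ} (hf : Measurable f) : Measurable (fun p : ℝ × ℝ => gg f p.1 p.2) := by
  unfold gg
  have := measurable_kap
  fun_prop

/-! ### Stein's equation -/

def gI (x : ℝ) : ℝ := ∫ t in Set.Iic x, Real.exp (-t ^ 2 / 2)
def gJ (x : ℝ) : ℝ := ∫ t in Set.Ioi x, Real.exp (-t ^ 2 / 2)
def gc : ℝ := Real.sqrt (2 * Real.pi)

lemma gauss_int : Integrable (fun t : ℝ => Real.exp (-t ^ 2 / 2)) := by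
  have := integrable_exp_neg_mul_sq (b := 1/2) (by norm_num)
  refine this.congr (ae_of_all _ fun t => ?_)
  simp only
  ring_nf

lemma gauss_total : ∫ t : ℝ, Real.exp (-t ^ 2 / 2) = gc := by
  have := integral_gaussian (1/2)
  unfold gc
  rw [show (2 * Real.pi) = Real.pi / (1/2) by ring, ← this]
  congr 1; ext t; ring_nf

lemma gI_add_gJ (x : ℝ) : gI x + gJ x = gc := by
  rw [← gauss_total]
  have := integral_add_compl (s := Set.Iic x) measurableSet_Iic gauss_int
  rw [Set.compl_Iic] at this
  exact this

lemma gI_nonneg (x : ℝ) : 0 ≤ gI x := integral_nonneg fun _ => (Real.exp_pos _).le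
lemma gJ_nonneg (x : ℝ) : 0 ≤ gJ x := integral_nonneg fun _ => (Real.exp_pos _).le

lemma gI_neg (x : ℝ) : gI (-x) = gJ x := by
  unfold gI gJ
  have := integral_comp_neg_Ioi (-x) (fun t : ℝ => Real.exp (-t ^ 2 / 2))
  have h2 := integral_comp_neg_Iic (-x) (fun t : ℝ => Real.exp (-t ^ 2 / 2))
  simp at h2
  exact h2

lemma gI_mono {x y : ℝ} (h : x ≤ y) : gI x ≤ gI y :=
  setIntegral_mono_set gauss_int.integrableOn (ae_of_all _ fun _ => (Real.exp_pos _).le)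
    (Set.Iic_subset_Iic.2 h).eventuallyLE

lemma gc_pos : 0 < gc := by unfold gc; positivity
lemma gc_le : gc ≤ 3 := by
  unfold gc
  apply Real.sqrt_le_iff.2
  have := Real.pi_lt_d2
  constructor <;> linarith
lemma gc_ge : 1 ≤ gc := by
  unfold gc
  apply Real.le_sqrt_of_sq_le
  have := Real.pi_gt_three
  linarith

lemma Phi_eq (z : ℝ) : Φ z = gI z / gc := by
  unfold Φ gI gc
  rw [integral_div]

lemma gI_hasDeriv (x : ℝ) : HasDerivAt gI (Real.exp (-x ^ 2 / 2)) x := by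
  have h : ∀ y, gI y = gI 0 + ∫ t in (0:ℝ)..y, Real.exp (-t ^ 2 / 2) := by
    intro y
    have := intervalIntegral.integral_Iic_sub_Iic (a := 0) (b := y) (μ := volume)
      (f := fun t : ℝ => Real.exp (-t ^ 2 / 2)) gauss_int.integrableOn gauss_int.integrableOn
    unfold gI
    linarith
  have hc : Continuous (fun t : ℝ => Real.exp (-t ^ 2 / 2)) := by fun_prop
  have h2 := (hc.integral_hasStrictDerivAt 0 x).hasDerivAt
  have h3 := h2.const_add (gI 0)
  exact h3.congr_of_eventuallyEq (Filter.Eventually.of_forall h)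

lemma gJ_hasDeriv (x : ℝ) : HasDerivAt gJ (-Real.exp (-x ^ 2 / 2)) x := by
  have h : gJ = fun y => gc - gI y := by
    ext y
    linarith [gI_add_gJ y]
  rw [h]
  exact (gI_hasDeriv x).const_sub gc

lemma gJ_tail {x : ℝ} (hx : 0 < x) : x * gJ x ≤ Real.exp (-x ^ 2 / 2) := by
  have hlim : Tendsto (fun t : ℝ => -Real.exp (-t ^ 2 / 2)) atTop (nhds 0) := by
    rw [← neg_zero]
    apply Tendsto.neg
    apply Real.tendsto_exp_atBot.comp
    have : Tendsto (fun t : ℝ => t ^ 2 / 2) atTop atTop :=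
      (tendsto_pow_atTop (by norm_num)).atTop_div_const (by norm_num)
    have := tendsto_neg_atTop_atBot.comp this
    refine this.congr fun t => ?_
    simp only [Function.comp]
    ring
  have hder : ∀ t ∈ Set.Ici x, HasDerivAt (fun t : ℝ => -Real.exp (-t ^ 2 / 2))
      (t * Real.exp (-t ^ 2 / 2)) t := by
    intro t _
    have h1 : HasDerivAt (fun t : ℝ => -t ^ 2 / 2) (-t) t := by
      have := ((hasDerivAt_pow 2 t).neg).div_const 2
      exact this.congr_deriv (by norm_num; ring)
    exact h1.exp.neg.congr_deriv (by ring)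
  have hpos : ∀ t ∈ Set.Ioi x, 0 ≤ t * Real.exp (-t ^ 2 / 2) := by
    intro t ht
    have : 0 < t := hx.trans ht
    positivity
  have h1 := integral_Ioi_of_hasDerivAt_of_nonneg' hder hpos hlim
  have hi := integrableOn_Ioi_deriv_of_nonneg' hder hpos hlim
  unfold gJ
  rw [← integral_const_mul]
  calc _ ≤ ∫ t in Set.Ioi x, t * Real.exp (-t ^ 2 / 2) := by
        apply setIntegral_mono_on (gauss_int.integrableOn.const_mul x) hi measurableSet_Ioi
        intro t ht
        have : x < t := ht
        gcongr
    _ = _ := by rw [h1]; ring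

/-- Solution of Stein's equation for the indicator of `Iic z`. -/
def stf (z x : ℝ) : ℝ := Real.exp (x ^ 2 / 2) * (gI (min x z) * gJ (max x z) / gc)

def stF (z x : ℝ) : ℝ := x * stf z x + (if x ≤ z then 1 else 0) - Φ z

lemma stf_nonneg (z x : ℝ) : 0 ≤ stf z x := by
  unfold stf
  have := gI_nonneg (min x z)
  have := gJ_nonneg (max x z)
  have := gc_pos
  positivity

lemma gJ_anti {x y : ℝ} (h : x ≤ y) : gJ y ≤ gJ x := by
  linarith [gI_add_gJ x, gI_add_gJ y, gI_mono h]

lemma stf_le_J (z x : ℝ) : stf z x ≤ Real.exp (x ^ 2 / 2) * gJ x := by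
  unfold stf
  have h1 := gI_nonneg (min x z)
  have h2 := gJ_nonneg (max x z)
  have h3 := gc_pos
  have h4 : gI (min x z) ≤ gc := by linarith [gI_add_gJ (min x z), gJ_nonneg (min x z)]
  have h5 : gJ (max x z) ≤ gJ x := gJ_anti (le_max_left _ _)
  gcongr
  rw [div_le_iff₀ h3]
  nlinarith

lemma stf_le_I (z x : ℝ) : stf z x ≤ Real.exp (x ^ 2 / 2) * gI x := by
  unfold stf
  have h1 := gI_nonneg (min x z)
  have h2 := gJ_nonneg (max x z)
  have h3 := gc_pos
  have h4 : gJ (max x z) ≤ gc := by linarith [gI_add_gJ (max x z), gI_nonneg (max x z)]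
  have h5 : gI (min x z) ≤ gI x := gI_mono (min_le_left _ _)
  gcongr
  rw [div_le_iff₀ h3]
  nlinarith

lemma mul_stf_bound (z x : ℝ) : |x| * stf z x ≤ 1 := by
  have key : ∀ y : ℝ, 0 < y → y * (Real.exp (y ^ 2 / 2) * gJ y) ≤ 1 := by
    intro y hy
    have := gJ_tail hy
    calc y * (Real.exp (y ^ 2 / 2) * gJ y) = Real.exp (y ^ 2 / 2) * (y * gJ y) := by ring
      _ ≤ Real.exp (y ^ 2 / 2) * Real.exp (-y ^ 2 / 2) := by gcongr
      _ = 1 := by rw [← Real.exp_add]; ring_nf; simp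
  rcases lt_trichotomy x 0 with h | h | h
  · rw [abs_of_neg h]
    have h1 := key (-x) (by linarith)
    have h2 := stf_le_I z x
    have h3 := gI_neg (-x)
    rw [neg_neg] at h3
    rw [← h3, neg_sq] at h1
    have : -x * stf z x ≤ -x * (Real.exp (x ^ 2 / 2) * gI x) := by
      apply mul_le_mul_of_nonneg_left h2; linarith
    linarith
  · simp [h]
  · rw [abs_of_pos h]
    have h1 := key x h
    have h2 := stf_le_J z x
    have : x * stf z x ≤ x * (Real.exp (x ^ 2 / 2) * gJ x) := by
      apply mul_le_mul_of_nonneg_left h2; linarith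
    linarith

lemma stf_bound (z x : ℝ) : |stf z x| ≤ 6 := by
  rw [abs_of_nonneg (stf_nonneg z x)]
  have h0 := stf_nonneg z x
  by_cases h : 1 ≤ |x|
  · have := mul_stf_bound z x
    nlinarith
  · push Not at h
    have h1 : x ^ 2 ≤ 1 := by
      rw [← sq_abs]; nlinarith [abs_nonneg x]
    have h2 := stf_le_I z x
    have h3 : gI x ≤ 3 := by linarith [gI_add_gJ x, gJ_nonneg x, gc_le]
    have h4 : Real.exp (x ^ 2 / 2) ≤ 2 := by
      have : Real.exp (x ^ 2 / 2) ≤ Real.exp (1/2) := by gcongr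
      have h5 : Real.exp (1/2) ^ 2 = Real.exp 1 := by rw [← Real.exp_nat_mul]; norm_num
      have := Real.exp_one_lt_d9
      nlinarith [Real.exp_pos (1/2)]
    have := gI_nonneg x
    have := Real.exp_pos (x ^ 2 / 2)
    nlinarith

lemma Phi_nonneg (z : ℝ) : 0 ≤ Φ z := by
  rw [Phi_eq]; exact div_nonneg (gI_nonneg z) gc_pos.le
lemma Phi_le_one (z : ℝ) : Φ z ≤ 1 := by
  rw [Phi_eq, div_le_one gc_pos]; linarith [gI_add_gJ z, gJ_nonneg z]

lemma stF_bound (z x : ℝ) : |stF z x| ≤ 2 := by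
  unfold stF
  have h1 : |x * stf z x| ≤ 1 := by
    rw [abs_mul, abs_of_nonneg (stf_nonneg z x)]; exact mul_stf_bound z x
  have := Phi_nonneg z
  have := Phi_le_one z
  rw [abs_le] at h1 ⊢
  split_ifs <;> constructor <;> linarith

lemma exp_half_deriv (x : ℝ) :
    HasDerivAt (fun x : ℝ => Real.exp (x ^ 2 / 2)) (x * Real.exp (x ^ 2 / 2)) x := by
  have h1 : HasDerivAt (fun t : ℝ => t ^ 2 / 2) x x := by
    have := (hasDerivAt_pow 2 x).div_const 2
    exact this.congr_deriv (by norm_num)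
  exact h1.exp.congr_deriv (by ring)

lemma exp_half_mul (x : ℝ) : Real.exp (x ^ 2 / 2) * Real.exp (-x ^ 2 / 2) = 1 := by
  rw [← Real.exp_add]; ring_nf; simp

lemma stf_hasDeriv {z x : ℝ} (hx : x ≠ z) : HasDerivAt (stf z) (stF z x) x := by
  have hc := gc_pos
  have he := exp_half_mul x
  rcases lt_or_gt_of_ne hx with h | h
  · have hd : HasDerivAt (fun x : ℝ => Real.exp (x ^ 2 / 2) * (gI x * gJ z / gc)) (stF z x) x := by
      have := (exp_half_deriv x).mul (((gI_hasDeriv x).mul_const (gJ z)).div_const gc)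
      refine this.congr_deriv ?_
      unfold stF stf
      rw [if_pos h.le, min_eq_left h.le, max_eq_right h.le, Phi_eq]
      have e : gI z = gc - gJ z := by linarith [gI_add_gJ z]
      rw [e]
      have : Real.exp (x ^ 2 / 2) * (Real.exp (-x ^ 2 / 2) * gJ z / gc) = gJ z / gc := by
        rw [mul_div_assoc, ← mul_assoc, he, one_mul]
      rw [this]
      field_simp
      ring
    refine hd.congr_of_eventuallyEq ?_
    filter_upwards [Iio_mem_nhds h] with y hy
    have hy : y < z := hy
    unfold stf
    rw [min_eq_left hy.le, max_eq_right hy.le]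
  · have hd : HasDerivAt (fun x : ℝ => Real.exp (x ^ 2 / 2) * (gI z * gJ x / gc)) (stF z x) x := by
      have := (exp_half_deriv x).mul (((gJ_hasDeriv x).const_mul (gI z)).div_const gc)
      refine this.congr_deriv ?_
      unfold stF stf
      rw [if_neg (not_le.2 h), min_eq_right h.le, max_eq_left h.le, Phi_eq]
      have : Real.exp (x ^ 2 / 2) * (gI z * -Real.exp (-x ^ 2 / 2) / gc) = - (gI z / gc) := by
        calc _ = - (Real.exp (x ^ 2 / 2) * Real.exp (-x ^ 2 / 2)) * (gI z / gc) := by ring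
          _ = _ := by rw [he]; ring
      rw [this]
      ring
    refine hd.congr_of_eventuallyEq ?_
    filter_upwards [Ioi_mem_nhds h] with y hy
    have hy : z < y := hy
    unfold stf
    rw [min_eq_right hy.le, max_eq_left hy.le]

lemma stf_cont (z : ℝ) : Continuous (stf z) := by
  have h1 : Continuous gI := continuous_iff_continuousAt.2 fun x => (gI_hasDeriv x).continuousAt
  have h2 : Continuous gJ := continuous_iff_continuousAt.2 fun x => (gJ_hasDeriv x).continuousAt
  unfold stf
  fun_prop

/-- mean value theorem away from `z`. -/
lemma stf_mvt {z x y : ℝ} (hxy : x < y) (hz : z ≤ x ∨ y ≤ z) :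
    ∃ c, x < c ∧ c < y ∧ stf z y - stf z x = stF z c * (y - x) := by
  obtain ⟨c, hc, h⟩ := exists_hasDerivAt_eq_slope (stf z) (stF z) hxy (stf_cont z).continuousOn
    (fun c hc => stf_hasDeriv (by
      rcases hz with hz | hz
      · exact (lt_of_le_of_lt hz hc.1).ne'
      · exact (lt_of_lt_of_le hc.2 hz).ne))
  refine ⟨c, hc.1, hc.2, ?_⟩
  rw [h]
  field_simp [sub_ne_zero.2 hxy.ne']

lemma stf_lip_aux {z x y : ℝ} (hxy : x < y) (hz : z ≤ x ∨ y ≤ z) :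
    |stf z y - stf z x| ≤ 2 * (y - x) := by
  obtain ⟨c, _, _, h⟩ := stf_mvt hxy hz
  rw [h, abs_mul, abs_of_pos (sub_pos.2 hxy)]
  have := stF_bound z c
  have : 0 < y - x := sub_pos.2 hxy
  gcongr

lemma stf_lip_lt {z x y : ℝ} (hxy : x < y) : |stf z y - stf z x| ≤ 2 * (y - x) := by
  by_cases h : z ≤ x ∨ y ≤ z
  · exact stf_lip_aux hxy h
  · push Not at h
    have h1 := stf_lip_aux (z := z) h.1 (Or.inr le_rfl)
    have h2 := stf_lip_aux (z := z) h.2 (Or.inl le_rfl)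
    have h3 := abs_add_le (stf z z - stf z x) (stf z y - stf z z)
    rw [show stf z z - stf z x + (stf z y - stf z z) = stf z y - stf z x by ring] at h3
    linarith

lemma stf_lip (z x y : ℝ) : |stf z x - stf z y| ≤ 2 * |x - y| := by
  rcases lt_trichotomy x y with h | h | h
  · rw [abs_sub_comm, abs_sub_comm x y, abs_of_pos (sub_pos.2 h)]; exact stf_lip_lt h
  · simp [h]
  · rw [abs_of_pos (sub_pos.2 h)]; exact stf_lip_lt h

/-- `x ↦ x f(x)` is locally Lipschitz. -/
lemma xstf_lip (z x y : ℝ) : |y * stf z y - x * stf z x| ≤ |y - x| * (6 + 2 * |x|) := by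
  have e : y * stf z y - x * stf z x = (y - x) * stf z y + x * (stf z y - stf z x) := by ring
  rw [e]
  refine (abs_add_le _ _).trans ?_
  rw [abs_mul, abs_mul]
  have h1 := stf_bound z y
  have h2 := stf_lip z y x
  calc _ ≤ |y - x| * 6 + |x| * (2 * |y - x|) := by gcongr
    _ = _ := by ring

/-- First-order expansion of the Stein solution. -/
lemma stf_expand (z x y : ℝ) :
    |stf z x - stf z y - stF z x * (x - y)| ≤
      |x - y| * (|x - y| * (6 + 2 * |x|) + (if |x - z| ≤ |x - y| then 4 else 0)) := by
  by_cases h : |x - z| ≤ |x - y|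
  · rw [if_pos h]
    have h1 := stf_lip z x y
    have h2 := stF_bound z x
    have h3 : |stF z x * (x - y)| ≤ 2 * |x - y| := by
      rw [abs_mul]; gcongr
    have h4 := abs_sub (stf z x - stf z y) (stF z x * (x - y))
    have h5 : 0 ≤ |x - y| * (|x - y| * (6 + 2 * |x|)) := by positivity
    rw [mul_add]
    linarith
  · rw [if_neg h, add_zero]
    push Not at h
    have main : ∀ c, |c - x| ≤ |x - y| → ((c ≤ z ∧ x ≤ z) ∨ (z < c ∧ z < x)) →
        stf z x - stf z y = stF z c * (x - y) → 
        |stf z x - stf z y - stF z x * (x - y)| ≤ |x - y| * (|x - y| * (6 + 2 * |x|)) := by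
      intro c hc hcz he
      rw [he, ← sub_mul, abs_mul, mul_comm]
      gcongr
      have e : stF z c - stF z x = c * stf z c - x * stf z x := by
        unfold stF
        rcases hcz with h | h
        · rw [if_pos h.1, if_pos h.2]; ring
        · rw [if_neg (not_le.2 h.1), if_neg (not_le.2 h.2)]; ring
      rw [e]
      refine (xstf_lip z x c).trans ?_
      gcongr
    rcases lt_trichotomy x y with hxy | hxy | hxy
    · rw [abs_of_neg (sub_neg.2 hxy)] at h
      have hz : z ≤ x ∨ y ≤ z := by
        by_contra hcon
        push Not at hcon
        rw [abs_of_neg (by linarith)] at h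
        linarith
      obtain ⟨c, h1, h2, h3⟩ := stf_mvt hxy hz
      apply main c _ _ (by linarith)
      · rw [abs_of_pos (by linarith), abs_of_neg (by linarith)]; linarith
      · rcases hz with hz | hz
        · rcases hz.lt_or_eq with hz | hz
          · right; constructor <;> linarith
          · rw [hz] at h; simp at h; linarith
        · left; constructor <;> linarith
    · rw [hxy]; simp
    · rw [abs_of_pos (sub_pos.2 hxy)] at h
      have hz : z ≤ y ∨ x ≤ z := by
        by_contra hcon
        push Not at hcon
        rw [abs_of_pos (by linarith)] at h
        linarith
      obtain ⟨c, h1, h2, h3⟩ := stf_mvt hxy hz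
      apply main c _ _ (by linarith)
      · rw [abs_of_neg (by linarith), abs_of_pos (by linarith)]; linarith
      · rcases hz with hz | hz
        · right; constructor <;> linarith
        · left; constructor <;> linarith

lemma measurable_stF (z : ℝ) : Measurable (stF z) := by
  unfold stF
  have := (stf_cont z).measurable
  refine ((measurable_id.mul this).add ?_).sub_const _
  exact Measurable.ite measurableSet_Iic measurable_const measurable_const

/-! ### Sums of independent random variables -/

structure Setup {Ω ι : Type*} [MeasurableSpace Ω] [Fintype ι] (P : Measure Ω)
    (X : ι → Ω → ℝ) (L : ℝ) : Prop where
  meas : ∀ i, Measurable (X i)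
  indep : iIndepFun X P
  int3 : ∀ i, Integrable (fun ω => |X i ω| ^ 3) P
  mean0 : ∀ i, ∫ ω, X i ω ∂P = 0
  var1 : ∑ i, ∫ ω, X i ω ^ 2 ∂P = 1
  hL : ∑ i, ∫ ω, |X i ω| ^ 3 ∂P = L
  pos : 0 < L
  small : L ≤ 1 / 24

section prob

set_option linter.unusedSectionVars false

variable {Ω ι : Type*} [MeasurableSpace Ω] [Fintype ι] [DecidableEq ι] {P : Measure Ω}
  [IsProbabilityMeasure P] {X : ι → Ω → ℝ} {L : ℝ}

lemma Setup.memLp3 (h : Setup P X L) (i : ι) : MemLp (X i) 3 P := by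
  refine (integrable_norm_rpow_iff (h.meas i).aestronglyMeasurable (by norm_num) (by norm_num)).1 ?_
  refine (h.int3 i).congr (ae_of_all _ fun ω => ?_)
  simp only [Real.norm_eq_abs]
  rw [show (3 : ENNReal).toReal = ((3 : ℕ) : ℝ) by norm_num, Real.rpow_natCast]

lemma Setup.memLp2 (h : Setup P X L) (i : ι) : MemLp (X i) 2 P :=
  (h.memLp3 i).mono_exponent (by norm_num)

lemma Setup.int2 (h : Setup P X L) (i : ι) : Integrable (fun ω => X i ω ^ 2) P :=
  (h.memLp2 i).integrable_sq

lemma Setup.int1 (h : Setup P X L) (i : ι) : Integrable (X i) P :=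
  (h.memLp2 i).integrable (by norm_num)

lemma Setup.L_nonneg (h : Setup P X L) : 0 ≤ L := by
  rw [← h.hL]
  exact Finset.sum_nonneg fun i _ => integral_nonneg fun ω => by positivity

def WA (X : ι → Ω → ℝ) (A : Finset ι) (ω : Ω) : ℝ := ∑ i ∈ A, X i ω
def SA (X : ι → Ω → ℝ) (A : Finset ι) (ω : Ω) : ℝ := ∑ i ∈ A, X i ω ^ 2

lemma Setup.mW (h : Setup P X L) (A : Finset ι) : Measurable (WA X A) := by
  have := h.meas
  unfold WA
  fun_prop

lemma Setup.mS (h : Setup P X L) (A : Finset ι) : Measurable (SA X A) := by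
  have := h.meas
  unfold SA
  fun_prop

lemma Setup.ind (h : Setup P X L) {A : Finset ι} {j : ι} (hj : j ∉ A) :
    IndepFun (X j) (fun ω => (WA X A ω, SA X A ω)) P := by
  have h1 : iIndepFun (fun i => (fun x : ℝ => (x, x ^ 2)) ∘ X i) P :=
    h.indep.comp (fun _ x => (x, x ^ 2)) (fun _ => by fun_prop)
  have h2 := h1.indepFun_finsetSum_of_notMem
    (fun i => (show Measurable (fun x : ℝ => (x, x ^ 2)) by fun_prop).comp (h.meas i)) hj
  have h3 := (h2.comp (φ := id) (ψ := Prod.fst) measurable_id measurable_fst).symm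
  have e1 : (Prod.fst ∘ ((fun x : ℝ => (x, x ^ 2)) ∘ X j)) = X j := by ext ω; rfl
  have e2 : (id ∘ ∑ i ∈ A, (fun x : ℝ => (x, x ^ 2)) ∘ X i) = fun ω => (WA X A ω, SA X A ω) := by
    ext ω <;> simp [WA, SA, Finset.sum_apply, Prod.fst_sum, Prod.snd_sum]
  rw [e1, e2] at h3
  exact h3

lemma Setup.memLpW (h : Setup P X L) (A : Finset ι) : MemLp (WA X A) 2 P := by
  have := memLp_finsetSum A (f := X) (fun i _ => h.memLp2 i)
  exact this

lemma Setup.W2 (h : Setup P X L) (A : Finset ι) : ∫ ω, WA X A ω ^ 2 ∂P ≤ 1 := by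
  have h1 : Var[∑ i ∈ A, X i; P] = ∑ i ∈ A, Var[X i; P] :=
    IndepFun.variance_sum (fun i _ => h.memLp2 i) (fun i _ j _ hij => h.indep.indepFun hij)
  have e : (∑ i ∈ A, X i) = WA X A := by ext ω; simp [WA]
  have h0 : ∫ ω, WA X A ω ∂P = 0 := by
    unfold WA
    rw [integral_finsetSum _ (fun i _ => h.int1 i)]
    exact Finset.sum_eq_zero fun i _ => h.mean0 i
  rw [e, variance_of_integral_eq_zero (h.mW A).aemeasurable h0] at h1
  rw [h1, ← h.var1]
  calc _ = ∑ i ∈ A, ∫ ω, X i ω ^ 2 ∂P := by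
        refine Finset.sum_congr rfl fun i _ => ?_
        rw [variance_of_integral_eq_zero (h.meas i).aemeasurable (h.mean0 i)]
    _ ≤ _ := Finset.sum_le_sum_of_subset_of_nonneg (Finset.subset_univ _)
        fun i _ _ => integral_nonneg fun ω => sq_nonneg _

lemma Setup.intW (h : Setup P X L) (A : Finset ι) : Integrable (WA X A) P :=
  (h.memLpW A).integrable (by norm_num)

lemma Setup.W1 (h : Setup P X L) (A : Finset ι) : ∫ ω, |WA X A ω| ∂P ≤ 1 := by
  have h2 := h.W2 A
  have : ∫ ω, |WA X A ω| ∂P ≤ ∫ ω, (1 + WA X A ω ^ 2) / 2 ∂P := by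
    apply integral_mono (h.intW A).abs
    · exact ((integrable_const 1).add (h.memLpW A).integrable_sq).div_const 2
    · intro ω
      simp only
      nlinarith [sq_nonneg (|WA X A ω| - 1), sq_abs (WA X A ω)]
  rw [integral_div, integral_add (integrable_const 1) (h.memLpW A).integrable_sq] at this
  simp at this
  linarith

lemma Setup.zero (h : Setup P X L) {A : Finset ι} {j : ι} (hj : j ∉ A) {G : ℝ × ℝ → ℝ}
    (hG : Measurable G) : ∫ ω, X j ω * G (WA X A ω, SA X A ω) ∂P = 0 := by
  have h1 := (h.ind hj).comp (φ := id) (ψ := G) measurable_id hG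
  have h2 := h1.integral_fun_mul_eq_mul_integral (h.meas j).aestronglyMeasurable
    (hG.comp ((h.mW A).prodMk (h.mS A))).aestronglyMeasurable
  simp only [Function.comp, id] at h2
  rw [h2, h.mean0, zero_mul]

lemma Setup.int3W (h : Setup P X L) {A : Finset ι} {j : ι} (hj : j ∉ A) :
    Integrable (fun ω => |X j ω| ^ 3 * |WA X A ω|) P := by
  have h1 := (h.ind hj).comp (φ := fun x => |x| ^ 3) (ψ := fun p => |p.1|) (by fun_prop) (by fun_prop)
  exact h1.integrable_mul (h.int3 j) (h.intW A).abs

lemma Setup.le3W (h : Setup P X L) {A : Finset ι} {j : ι} (hj : j ∉ A) :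
    ∫ ω, |X j ω| ^ 3 * |WA X A ω| ∂P ≤ ∫ ω, |X j ω| ^ 3 ∂P := by
  have h1 := (h.ind hj).comp (φ := fun x => |x| ^ 3) (ψ := fun p => |p.1|) (by fun_prop) (by fun_prop)
  have h2 := h1.integral_fun_mul_eq_mul_integral (h.int3 j).1 (h.intW A).abs.1
  simp only [Function.comp] at h2
  rw [h2]
  have h3 := h.W1 A
  have : 0 ≤ ∫ ω, |X j ω| ^ 3 ∂P := integral_nonneg fun ω => by positivity
  nlinarith

/-- Conditioning on one coordinate. -/
lemma Setup.condition (h : Setup P X L) {A : Finset ι} {j : ι} (hj : j ∉ A)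
    {F : ℝ → ℝ × ℝ → ℝ} (hF : Measurable (Function.uncurry F)) {K : ℝ → ℝ} (hK : Measurable K)
    (hKi : Integrable (fun ω => K (X j ω)) P)
    (hFi : Integrable (fun ω => F (X j ω) (WA X A ω, SA X A ω)) P)
    (hle : ∀ x, ∫ ω, F x (WA X A ω, SA X A ω) ∂P ≤ K x) :
    ∫ ω, F (X j ω) (WA X A ω, SA X A ω) ∂P ≤ ∫ ω, K (X j ω) ∂P := by
  have hm := (h.mW A).prodMk (h.mS A)
  have h1 := (indepFun_iff_map_prod_eq_prod_map_map (h.meas j).aemeasurable hm.aemeasurable).1 (h.ind hj)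
  have hmm := (h.meas j).prodMk hm
  have e1 : ∫ ω, F (X j ω) (WA X A ω, SA X A ω) ∂P =
      ∫ p, Function.uncurry F p ∂(P.map (fun ω => (X j ω, (WA X A ω, SA X A ω)))) := by
    rw [integral_map hmm.aemeasurable hF.aestronglyMeasurable]
    rfl
  have i1 : Integrable (Function.uncurry F) (P.map (fun ω => (X j ω, (WA X A ω, SA X A ω)))) := by
    rw [integrable_map_measure hF.aestronglyMeasurable hmm.aemeasurable]
    exact hFi
  have : IsProbabilityMeasure (P.map (X j)) := Measure.isProbabilityMeasure_map (h.meas j).aemeasurable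
  have : IsProbabilityMeasure (P.map (fun ω => (WA X A ω, SA X A ω))) :=
    Measure.isProbabilityMeasure_map hm.aemeasurable
  rw [h1] at e1 i1
  rw [e1, integral_prod _ i1]
  have e2 : ∫ ω, K (X j ω) ∂P = ∫ x, K x ∂(P.map (X j)) := by
    rw [integral_map (h.meas j).aemeasurable hK.aestronglyMeasurable]
  rw [e2]
  apply integral_mono i1.integral_prod_left
  · rw [integrable_map_measure hK.aestronglyMeasurable (h.meas j).aemeasurable]
    exact hKi
  · intro x
    simp only [Function.uncurry]
    rw [integral_map hm.aemeasurable]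
    · exact hle x
    · exact (hF.comp (measurable_prodMk_left (x := x))).aestronglyMeasurable

/-! truncated squares -/

def tsq (δ x : ℝ) : ℝ := if |x| ≤ δ then x ^ 2 else 0

lemma measurable_tsq (δ : ℝ) : Measurable (tsq δ) := by
  unfold tsq
  exact Measurable.ite (measurableSet_le (by fun_prop) (by fun_prop)) (by fun_prop) (by fun_prop)

lemma tsq_nonneg (δ x : ℝ) : 0 ≤ tsq δ x := by
  unfold tsq; split_ifs <;> positivity

lemma tsq_le (δ x : ℝ) : tsq δ x ≤ x ^ 2 := by
  unfold tsq; split_ifs <;> nlinarith [sq_nonneg x]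

lemma tsq_bound {δ : ℝ} (x : ℝ) : tsq δ x ≤ δ ^ 2 := by
  unfold tsq
  split_ifs with h
  · rw [← sq_abs]; gcongr
  · positivity

lemma tsq_sq {δ : ℝ} (hδ : 0 ≤ δ) (x : ℝ) : tsq δ x ^ 2 ≤ δ * |x| ^ 3 := by
  unfold tsq
  split_ifs with h
  · have e : (x ^ 2) ^ 2 = |x| * |x| ^ 3 := by
      have := sq_abs x
      rw [← this]
      ring
    rw [e]
    gcongr
  · simp; positivity

lemma sq_sub_tsq {δ : ℝ} (hδ : 0 < δ) (x : ℝ) : x ^ 2 - tsq δ x ≤ |x| ^ 3 / δ := by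
  unfold tsq
  split_ifs with h
  · simp; positivity
  · push Not at h
    rw [← sq_abs, le_div_iff₀ hδ]
    nlinarith [sq_nonneg |x|]

def QA (X : ι → Ω → ℝ) (δ : ℝ) (A : Finset ι) (ω : Ω) : ℝ := ∑ i ∈ A, tsq δ (X i ω)

lemma Setup.mT (h : Setup P X L) (δ : ℝ) (i : ι) : Measurable (fun ω => tsq δ (X i ω)) :=
  (measurable_tsq δ).comp (h.meas i)

lemma Setup.tLp (h : Setup P X L) (δ : ℝ) (i : ι) : MemLp (fun ω => tsq δ (X i ω)) 2 P := by
  apply MemLp.of_bound (h.mT δ i).aestronglyMeasurable (δ ^ 2)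
  refine ae_of_all _ fun ω => ?_
  rw [Real.norm_eq_abs, abs_of_nonneg (tsq_nonneg _ _)]
  exact tsq_bound _

lemma Setup.QLp (h : Setup P X L) (δ : ℝ) (A : Finset ι) : MemLp (QA X δ A) 2 P :=
  memLp_finsetSum A (fun i _ => h.tLp δ i)

lemma Setup.Qint (h : Setup P X L) (δ : ℝ) (A : Finset ι) : Integrable (QA X δ A) P :=
  (h.QLp δ A).integrable (by norm_num)

lemma Setup.Qdev_int (h : Setup P X L) (δ c : ℝ) (A : Finset ι) :
    Integrable (fun ω => (QA X δ A ω - c) ^ 2) P :=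
  ((h.QLp δ A).sub (memLp_const c)).integrable_sq

lemma Setup.Qvar (h : Setup P X L) {δ : ℝ} (hδ : 0 ≤ δ) (A : Finset ι) :
    ∫ ω, (QA X δ A ω - ∫ ω', QA X δ A ω' ∂P) ^ 2 ∂P ≤ δ * L := by
  have h1 : Var[∑ i ∈ A, (fun ω => tsq δ (X i ω)); P] = ∑ i ∈ A, Var[fun ω => tsq δ (X i ω); P] :=
    IndepFun.variance_sum (fun i _ => h.tLp δ i) (fun i _ j _ hij =>
      (h.indep.indepFun hij).comp (measurable_tsq δ) (measurable_tsq δ))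
  have e : (∑ i ∈ A, (fun ω => tsq δ (X i ω))) = QA X δ A := by ext ω; simp [QA]
  rw [e, variance_eq_integral (h.QLp δ A).aemeasurable] at h1
  rw [h1, ← h.hL, Finset.mul_sum]
  calc _ ≤ ∑ i ∈ A, δ * ∫ ω, |X i ω| ^ 3 ∂P := by
        refine Finset.sum_le_sum fun i _ => ?_
        refine (variance_le_expectation_sq (h.mT δ i).aestronglyMeasurable).trans ?_
        rw [← integral_const_mul]
        apply integral_mono (h.tLp δ i).integrable_sq ((h.int3 i).const_mul δ)
        intro ω
        exact tsq_sq hδ _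
    _ ≤ _ := Finset.sum_le_sum_of_subset_of_nonneg (Finset.subset_univ _)
        fun i _ _ => mul_nonneg hδ (integral_nonneg fun ω => by positivity)

lemma Setup.Qmean (h : Setup P X L) {δ : ℝ} (hδ : 0 < δ) (A : Finset ι) :
    ∑ i ∈ A, ∫ ω, X i ω ^ 2 ∂P - L / δ ≤ ∫ ω, QA X δ A ω ∂P := by
  unfold QA
  rw [integral_finsetSum _ (fun i _ => (h.tLp δ i).integrable (by norm_num))]
  have : ∑ i ∈ A, (∫ ω, X i ω ^ 2 ∂P - ∫ ω, tsq δ (X i ω) ∂P) ≤ L / δ := by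
    rw [← h.hL, Finset.sum_div]
    calc _ ≤ ∑ i ∈ A, (∫ ω, |X i ω| ^ 3 ∂P) / δ := by
          refine Finset.sum_le_sum fun i _ => ?_
          rw [← integral_sub (h.int2 i) ((h.tLp δ i).integrable (by norm_num)), ← integral_div]
          apply integral_mono ((h.int2 i).sub ((h.tLp δ i).integrable (by norm_num)))
            ((h.int3 i).div_const δ)
          intro ω
          exact sq_sub_tsq hδ _
      _ ≤ _ := Finset.sum_le_sum_of_subset_of_nonneg (Finset.subset_univ _)
        fun i _ _ => div_nonneg (integral_nonneg fun ω => by positivity) hδ.le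
  rw [Finset.sum_sub_distrib] at this
  linarith

lemma Setup.Qmean_le (h : Setup P X L) {δ : ℝ} (A : Finset ι) :
    ∫ ω, QA X δ A ω ∂P ≤ 1 := by
  unfold QA
  rw [integral_finsetSum _ (fun i _ => (h.tLp δ i).integrable (by norm_num)), ← h.var1]
  calc _ ≤ ∑ i ∈ A, ∫ ω, X i ω ^ 2 ∂P := by
        refine Finset.sum_le_sum fun i _ => ?_
        apply integral_mono ((h.tLp δ i).integrable (by norm_num)) (h.int2 i)
        intro ω
        exact tsq_le _ _
    _ ≤ _ := Finset.sum_le_sum_of_subset_of_nonneg (Finset.subset_univ _)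
        fun i _ _ => (integral_nonneg fun ω => by positivity)

lemma Setup.erase_var (h : Setup P X L) (i : ι) :
    3 / 4 ≤ ∑ j ∈ Finset.univ.erase i, ∫ ω, X j ω ^ 2 ∂P := by
  have h1 := h.var1
  rw [← Finset.add_sum_erase _ _ (Finset.mem_univ i)] at h1
  have h2 : ∫ ω, X i ω ^ 2 ∂P ≤ ∫ ω, (1 / 8 + 3 * |X i ω| ^ 3) ∂P := by
    apply integral_mono (h.int2 i) ((integrable_const _).add ((h.int3 i).const_mul 3))
    intro ω
    change X i ω ^ 2 ≤ 1 / 8 + 3 * |X i ω| ^ 3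
    rw [← sq_abs]
    have h0 := abs_nonneg (X i ω)
    set x := |X i ω|
    by_cases hx : x ≤ 1 / 3
    · nlinarith [pow_nonneg h0 3]
    · push Not at hx
      nlinarith [sq_nonneg x]
  rw [integral_add (integrable_const _) ((h.int3 i).const_mul 3), integral_const_mul] at h2
  simp at h2
  have h3 : ∫ ω, |X i ω| ^ 3 ∂P ≤ L := by
    rw [← h.hL]
    exact Finset.single_le_sum (f := fun i => ∫ ω, |X i ω| ^ 3 ∂P)
      (fun i _ => integral_nonneg fun ω => by positivity) (Finset.mem_univ i)
  have := h.small
  linarith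

/-! ### Concentration inequality -/

def cf (z b x : ℝ) : ℝ := max (-b) (min b (x - z))

lemma cf_bound {b : ℝ} (hb : 0 ≤ b) (z x : ℝ) : |cf z b x| ≤ b := by
  unfold cf
  rw [abs_le]
  exact ⟨le_max_left _ _, max_le (by linarith) (min_le_left _ _)⟩

lemma cf_mono (z b : ℝ) : Monotone (cf z b) := by
  intro x y h
  unfold cf
  gcongr

lemma cf_eq {z b x : ℝ} (h : |x - z| ≤ b) : cf z b x = x - z := by
  rw [abs_le] at h
  unfold cf
  rw [min_eq_right h.2, max_eq_right h.1]

lemma cf_lip (z b x y : ℝ) : |cf z b x - cf z b y| ≤ 1 * |x - y| := by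
  unfold cf
  have h1 := abs_max_sub_max_le_max (-b) (min b (x - z)) (-b) (min b (y - z))
  have h2 := abs_min_sub_min_le_max b (x - z) b (y - z)
  simp at h1 h2
  linarith

lemma measurable_cf (z b : ℝ) : Measurable (cf z b) := (cf_mono z b).measurable

lemma conc_pt (z W s x : ℝ) {a δ : ℝ} :
    (if |W * kap s - z| ≤ a then (1/4) * tsq δ x else 0) ≤
      x * (gg (cf z (a + 2 * δ)) W s - gg (cf z (a + 2 * δ)) (W - x) s) := by
  have hk := kap_pos s
  have hk2 := kap_le s
  have hk1 := kap_ge s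
  have nn : 0 ≤ x * (gg (cf z (a + 2 * δ)) W s - gg (cf z (a + 2 * δ)) (W - x) s) := by
    unfold gg
    rw [← sub_mul, ← mul_assoc]
    refine mul_nonneg ?_ hk.le
    rcases le_total 0 x with hx | hx
    · refine mul_nonneg hx (sub_nonneg.2 (cf_mono _ _ ?_))
      nlinarith
    · refine mul_nonneg_of_nonpos_of_nonpos hx (sub_nonpos.2 (cf_mono _ _ ?_))
      nlinarith
  split_ifs with h
  · unfold tsq
    split_ifs with h2
    · have hd : 0 ≤ δ := (abs_nonneg _).trans h2
      unfold gg
      rw [cf_eq (by linarith), cf_eq]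
      · have : x * ((W * kap s - z) * kap s - ((W - x) * kap s - z) * kap s) = x ^ 2 * kap s ^ 2 := by ring
        rw [this]
        nlinarith [sq_nonneg x, mul_nonneg (sq_nonneg x) (show 0 ≤ kap s ^ 2 - 1/4 by nlinarith)]
      · rw [show (W - x) * kap s - z = (W * kap s - z) - x * kap s by ring]
        refine (abs_sub _ _).trans ?_
        rw [abs_mul, abs_of_pos hk]
        nlinarith [abs_nonneg x]
    · simpa using nn
  · exact nn

lemma conc_pt2 (z W s x : ℝ) {a δ : ℝ} (ha : 0 ≤ a) (hδ : 0 ≤ δ) :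
    (if |W * kap s - z| ≤ a then (1/4) * tsq δ x else 0) ≤
      x * (gg (cf z (a + 2 * δ)) W s - gg (cf z (a + 2 * δ)) (W - x) (s - x ^ 2))
      + 4 * |x| ^ 3 * (2 * |W - x| + (a + 2 * δ)) := by
  have h1 := conc_pt z W s x (a := a) (δ := δ)
  set f := cf z (a + 2 * δ)
  have h2 := gg_diff (f := f) zero_le_one (cf_bound (by linarith) z) (cf_lip z (a + 2 * δ)) (W - x)
    s (s - x ^ 2)
  rw [show s - (s - x ^ 2) = x ^ 2 by ring, abs_of_nonneg (sq_nonneg x)] at h2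
  have h3 : |x * (gg f (W - x) s - gg f (W - x) (s - x ^ 2))| ≤
      4 * |x| ^ 3 * (2 * |W - x| + (a + 2 * δ)) := by
    rw [abs_mul]
    calc _ ≤ |x| * (4 * x ^ 2 * (2 * 1 * |W - x| + (a + 2 * δ))) := by gcongr
      _ = _ := by rw [← sq_abs x]; ring
  have h4 := (abs_le.1 h3).1
  have e : x * (gg f W s - gg f (W - x) (s - x ^ 2)) = x * (gg f W s - gg f (W - x) s) +
    x * (gg f (W - x) s - gg f (W - x) (s - x ^ 2)) := by ring
  rw [e]
  linarith

lemma WA_erase {A : Finset ι} {j : ι} (hj : j ∈ A) (ω : Ω) :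
    WA X A ω - X j ω = WA X (A.erase j) ω := by
  unfold WA
  rw [← Finset.add_sum_erase _ _ hj]; ring

lemma SA_erase {A : Finset ι} {j : ι} (hj : j ∈ A) (ω : Ω) :
    SA X A ω - X j ω ^ 2 = SA X (A.erase j) ω := by
  unfold SA
  rw [← Finset.add_sum_erase _ _ hj]; ring

lemma conc_pw (A : Finset ι) {r : ℝ} (hr : |r| ≤ 1) (z : ℝ) {a δ c : ℝ} (ha : 0 ≤ a) (hδ : 0 ≤ δ)
    (hc : 1 / 2 ≤ c) (ω : Ω) :
    (if |(WA X A ω + r) * kap (SA X A ω + r ^ 2) - z| ≤ a then (1/16 : ℝ) else 0)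
      - (QA X δ A ω - c) ^ 2 / 4 ≤
    2 * (a + 2 * δ) * |WA X A ω|
     - ∑ j ∈ A, X j ω * gg (cf z (a + 2 * δ)) (WA X (A.erase j) ω + r) (SA X (A.erase j) ω + r ^ 2)
     + ∑ j ∈ A, (8 * (|X j ω| ^ 3 * |WA X (A.erase j) ω|) + 4 * (2 + (a + 2 * δ)) * |X j ω| ^ 3) := by
  set f := cf z (a + 2 * δ)
  set W := WA X A ω + r
  set s := SA X A ω + r ^ 2
  have h1 : ∑ j ∈ A, (if |W * kap s - z| ≤ a then (1/4) * tsq δ (X j ω) else 0) ≤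
      ∑ j ∈ A, (X j ω * gg f W s
        - X j ω * gg f (WA X (A.erase j) ω + r) (SA X (A.erase j) ω + r ^ 2)
        + (8 * (|X j ω| ^ 3 * |WA X (A.erase j) ω|) + 4 * (2 + (a + 2 * δ)) * |X j ω| ^ 3)) := by
    refine Finset.sum_le_sum fun j hj => ?_
    refine (conc_pt2 z W s (X j ω) ha hδ).trans ?_
    have e1 : W - X j ω = WA X (A.erase j) ω + r := by rw [← WA_erase hj]; ring
    have e2 : s - X j ω ^ 2 = SA X (A.erase j) ω + r ^ 2 := by rw [← SA_erase hj]; ring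
    rw [e1, e2, mul_sub]
    have : |WA X (A.erase j) ω + r| ≤ |WA X (A.erase j) ω| + 1 := (abs_add_le _ _).trans (by linarith)
    have h3 : 0 ≤ |X j ω| ^ 3 := by positivity
    have := mul_le_mul_of_nonneg_left this h3
    linarith
  rw [Finset.sum_add_distrib, Finset.sum_sub_distrib, ← Finset.sum_mul] at h1
  have h2 : (∑ j ∈ A, X j ω) * gg f W s ≤ 2 * (a + 2 * δ) * |WA X A ω| := by
    refine (le_abs_self _).trans ?_
    rw [abs_mul, mul_comm]
    have := gg_bound (f := f) (cf_bound (by linarith) z) W s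
    exact mul_le_mul this le_rfl (abs_nonneg _) (by linarith)
  have h3 : (if |W * kap s - z| ≤ a then (1/16 : ℝ) else 0) - (QA X δ A ω - c) ^ 2 / 4 ≤
      ∑ j ∈ A, (if |W * kap s - z| ≤ a then (1/4) * tsq δ (X j ω) else 0) := by
    split_ifs with h
    · rw [← Finset.mul_sum]
      change _ ≤ 1 / 4 * QA X δ A ω
      set q := QA X δ A ω
      by_cases hq : q ≤ 1 / 4
      · nlinarith [sq_nonneg (1/4 - q - 1/4), mul_nonneg (show 0 ≤ c - 1/2 by linarith) (show 0 ≤ c + 1/2 - 2 * q by linarith)]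
      · nlinarith [sq_nonneg (q - c)]
    · simp; positivity
  linarith

lemma meas_T {A : Finset ι} (h : Setup P X L) (r : ℝ) :
    Measurable (fun ω => (WA X A ω + r) * kap (SA X A ω + r ^ 2)) :=
  ((h.mW A).add_const r).mul (measurable_kap.comp ((h.mS A).add_const _))

lemma Setup.conc (h : Setup P X L) {A : Finset ι} (hA : 3 / 4 ≤ ∑ j ∈ A, ∫ ω, X j ω ^ 2 ∂P)
    {r : ℝ} (hr : |r| ≤ 1) (z : ℝ) {a : ℝ} (ha : 0 ≤ a) :
    ∫ ω, (if |(WA X A ω + r) * kap (SA X A ω + r ^ 2) - z| ≤ a then (1 : ℝ) else 0) ∂P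
      ≤ 48 * a + 656 * L := by
  have hL := h.pos
  have hLs := h.small
  obtain ⟨δ, hδ⟩ : ∃ δ, δ = 4 * L := ⟨_, rfl⟩
  have hδ0 : 0 < δ := by linarith
  obtain ⟨c, hc⟩ : ∃ c, c = ∫ ω, QA X δ A ω ∂P := ⟨_, rfl⟩
  have hc1 : 1 / 2 ≤ c := by
    have := h.Qmean hδ0 A
    have e : L / δ = 1 / 4 := by rw [hδ]; field_simp
    rw [e] at this
    linarith
  have hm : MeasurableSet {ω | |(WA X A ω + r) * kap (SA X A ω + r ^ 2) - z| ≤ a} :=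
    measurableSet_le ((meas_T h r).sub_const z).abs measurable_const
  have hi : ∀ t : ℝ, Integrable
      (fun ω => if |(WA X A ω + r) * kap (SA X A ω + r ^ 2) - z| ≤ a then t else 0) P := by
    intro t
    refine Integrable.of_bound (C := |t|)
      (Measurable.ite hm measurable_const measurable_const).aestronglyMeasurable
      (ae_of_all _ fun ω => ?_)
    split_ifs <;> simp
  have hGm := measurable_gg (measurable_cf z (a + 2 * δ))
  have hGm' : Measurable (fun p : ℝ × ℝ => gg (cf z (a + 2 * δ)) (p.1 + r) (p.2 + r ^ 2)) :=
    hGm.comp (f := fun p : ℝ × ℝ => (p.1 + r, p.2 + r ^ 2)) (by fun_prop)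
  have i1 := (h.intW A).abs.const_mul (2 * (a + 2 * δ))
  have i2 : ∀ j, Integrable (fun ω => X j ω * gg (cf z (a + 2 * δ))
      (WA X (A.erase j) ω + r) (SA X (A.erase j) ω + r ^ 2)) P := by
    intro j
    refine (h.int1 j).mul_bdd (c := 2 * (a + 2 * δ))
      (hGm'.comp ((h.mW _).prodMk (h.mS _))).aestronglyMeasurable (ae_of_all _ fun ω => ?_)
    exact gg_bound (cf_bound (by linarith) z) _ _
  have i3 : ∀ j, Integrable (fun ω => 8 * (|X j ω| ^ 3 * |WA X (A.erase j) ω|) +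
      4 * (2 + (a + 2 * δ)) * |X j ω| ^ 3) P := fun j =>
    ((h.int3W (Finset.notMem_erase j A)).const_mul 8).add ((h.int3 j).const_mul _)
  have i2s := integrable_finsetSum A (fun j _ => i2 j)
  have i3s := integrable_finsetSum A (fun j _ => i3 j)
  have key := integral_mono ((hi (1/16)).sub ((h.Qdev_int δ c A).div_const 4))
    ((i1.sub i2s).add i3s) (fun ω => conc_pw (X := X) A hr z ha hδ0.le hc1 ω)
  have e0 : ∫ ω, (if |(WA X A ω + r) * kap (SA X A ω + r ^ 2) - z| ≤ a then (1/16 : ℝ) else 0) ∂P =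
      (1/16) * ∫ ω, (if |(WA X A ω + r) * kap (SA X A ω + r ^ 2) - z| ≤ a then (1 : ℝ) else 0) ∂P := by
    rw [← integral_const_mul]
    congr 1; ext ω; split_ifs <;> simp
  rw [integral_sub' (hi (1/16)) ((h.Qdev_int δ c A).div_const 4), integral_add' (i1.sub i2s) i3s,
    integral_sub' i1 i2s, integral_finsetSum _ (fun j _ => i2 j), integral_finsetSum _ (fun j _ => i3 j),
    integral_div, integral_const_mul, e0] at key
  have z1 : ∑ j ∈ A, ∫ ω, X j ω * gg (cf z (a + 2 * δ))
      (WA X (A.erase j) ω + r) (SA X (A.erase j) ω + r ^ 2) ∂P = 0 :=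
    Finset.sum_eq_zero fun j _ => h.zero (Finset.notMem_erase j A) hGm'
  have z2 : ∑ j ∈ A, ∫ ω, (8 * (|X j ω| ^ 3 * |WA X (A.erase j) ω|) +
      4 * (2 + (a + 2 * δ)) * |X j ω| ^ 3) ∂P ≤ (8 + 4 * (2 + (a + 2 * δ))) * L := by
    rw [← h.hL, Finset.mul_sum]
    calc _ ≤ ∑ j ∈ A, (8 + 4 * (2 + (a + 2 * δ))) * ∫ ω, |X j ω| ^ 3 ∂P := by
          refine Finset.sum_le_sum fun j _ => ?_
          rw [integral_add ((h.int3W (Finset.notMem_erase j A)).const_mul 8) ((h.int3 j).const_mul _),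
            integral_const_mul, integral_const_mul]
          have := h.le3W (Finset.notMem_erase j A)
          linarith
      _ ≤ _ := Finset.sum_le_sum_of_subset_of_nonneg (Finset.subset_univ _)
        fun i _ _ => mul_nonneg (by linarith) (integral_nonneg fun ω => by positivity)
  have v := h.Qvar hδ0.le A
  rw [← hc] at v
  have w1 := h.W1 A
  rw [z1] at key
  have w2 := mul_le_mul_of_nonneg_left w1 (show 0 ≤ 2 * (a + 2 * δ) by linarith)
  rw [hδ] at *
  nlinarith [mul_nonneg ha (show 0 ≤ 1/24 - L by linarith), mul_nonneg hL.le (show 0 ≤ 1/24 - L by linarith)]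

/-! ### Main bound -/

lemma dev_pt {q R c : ℝ} (hq : 0 ≤ q) (hR : 0 ≤ R) (hc : 3 / 4 ≤ c) (hc1 : c ≤ 1) :
    |(q + R) * kap (q + R) ^ 2 - 1| ≤ 4 * (q - c) ^ 2 + R ∧
    (if 1 / 4 ≤ q + R ∧ q + R ≤ 4 then (0 : ℝ) else 1) ≤ 4 * (q - c) ^ 2 + R := by
  rw [kap_sq]
  unfold clp
  have hsq := sq_nonneg (q - c)
  by_cases h1 : q + R < 1 / 4
  · rw [min_eq_right (by linarith), max_eq_left (by linarith), if_neg (by intro h; linarith [h.1])]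
    have : 1 ≤ 4 * (q - c) ^ 2 := by nlinarith
    constructor
    · rw [abs_le]; constructor <;> linarith
    · linarith
  · push Not at h1
    by_cases h2 : q + R ≤ 4
    · rw [min_eq_right h2, max_eq_right h1, if_pos ⟨h1, h2⟩]
      have : q + R ≠ 0 := by linarith
      rw [mul_inv_cancel₀ this]
      simp
      positivity
    · push Not at h2
      rw [min_eq_left h2.le, max_eq_right (by norm_num), if_neg (by intro h; linarith [h.2])]
      have key : (q + R) / 4 ≤ 4 * (q - c) ^ 2 + R := by
        by_cases h3 : q ≤ 2
        · linarith
        · push Not at h3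
          nlinarith
      constructor
      · rw [abs_le]; constructor <;> linarith
      · linarith

/-- The self-normalised (truncated) statistic. -/
def TT (X : ι → Ω → ℝ) (ω : Ω) : ℝ := WA X Finset.univ ω * kap (SA X Finset.univ ω)

def R1 (X : ι → Ω → ℝ) (ω : Ω) : ℝ := SA X Finset.univ ω - QA X 1 Finset.univ ω

lemma Setup.intS (h : Setup P X L) (A : Finset ι) : Integrable (SA X A) P :=
  integrable_finsetSum A (fun i _ => h.int2 i)

lemma R1_nonneg (ω : Ω) : 0 ≤ R1 X ω := by
  unfold R1 SA QA
  rw [← Finset.sum_sub_distrib]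
  exact Finset.sum_nonneg fun i _ => sub_nonneg.2 (tsq_le _ _)

lemma Setup.R1_int (h : Setup P X L) : Integrable (R1 X) P := (h.intS _).sub (h.Qint _ _)

lemma Setup.R1_le (h : Setup P X L) : ∫ ω, R1 X ω ∂P ≤ L := by
  unfold R1
  rw [integral_sub (h.intS _) (h.Qint _ _)]
  have h1 := h.Qmean one_pos Finset.univ
  have h2 : ∫ ω, SA X Finset.univ ω ∂P = 1 := by
    unfold SA
    rw [integral_finsetSum _ (fun i _ => h.int2 i), h.var1]
  rw [h.var1] at h1
  rw [h2]
  linarith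

/-- The deviation majorant. -/
def Dv (P : Measure Ω) (X : ι → Ω → ℝ) (ω : Ω) : ℝ :=
  4 * (QA X 1 Finset.univ ω - ∫ ω', QA X 1 Finset.univ ω' ∂P) ^ 2 + R1 X ω

lemma Setup.Dv_int (h : Setup P X L) : Integrable (Dv P X) P :=
  ((h.Qdev_int _ _ _).const_mul 4).add h.R1_int

lemma Setup.Dv_le (h : Setup P X L) : ∫ ω, Dv P X ω ∂P ≤ 5 * L := by
  unfold Dv
  rw [integral_add ((h.Qdev_int _ _ _).const_mul 4) h.R1_int, integral_const_mul]
  have := h.Qvar zero_le_one Finset.univ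
  have := h.R1_le
  linarith

lemma Setup.Dv_pt (h : Setup P X L) (ω : Ω) :
    |SA X Finset.univ ω * kap (SA X Finset.univ ω) ^ 2 - 1| ≤ Dv P X ω ∧
    (if 1 / 4 ≤ SA X Finset.univ ω ∧ SA X Finset.univ ω ≤ 4 then (0 : ℝ) else 1) ≤ Dv P X ω := by
  have h1 := h.Qmean one_pos Finset.univ
  rw [h.var1] at h1
  have h2 := h.small
  have e : SA X Finset.univ ω = QA X 1 Finset.univ ω + R1 X ω := by unfold R1; ring
  rw [e]
  exact dev_pt (Finset.sum_nonneg fun i _ => tsq_nonneg _ _) (R1_nonneg ω) (by linarith)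
    (h.Qmean_le _)

lemma stein_pt (z W s x : ℝ) :
    |x * gg (stf z) W s - x * gg (stf z) (W - x) (s - x ^ 2) - x ^ 2 * (kap s ^ 2 * stF z (W * kap s))| ≤
      16 * (x ^ 2 * (if |W * kap s - z| ≤ 2 * |x| then 1 else 0)) + 120 * |x| ^ 3
        + 48 * (|x| ^ 3 * |W - x|) := by
  have hk := kap_pos s
  have hk2 := kap_le s
  have hx0 := abs_nonneg x
  have h2 := gg_diff (f := stf z) zero_le_two (stf_bound z) (stf_lip z) (W - x) s (s - x ^ 2)
  rw [show s - (s - x ^ 2) = x ^ 2 by ring, abs_of_nonneg (sq_nonneg x)] at h2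
  have h3 : |x * (gg (stf z) (W - x) s - gg (stf z) (W - x) (s - x ^ 2))| ≤
      16 * (|x| ^ 3 * |W - x|) + 24 * |x| ^ 3 := by
    rw [abs_mul]
    calc _ ≤ |x| * (4 * x ^ 2 * (2 * 2 * |W - x| + 6)) := by gcongr
      _ = _ := by rw [← sq_abs x]; ring
  set a := W * kap s with ha
  set b := (W - x) * kap s with hb
  have hab : a - b = x * kap s := by rw [ha, hb]; ring
  have habs : |a - b| ≤ 2 * |x| := by
    rw [hab, abs_mul, abs_of_pos hk]; nlinarith
  have e : x * gg (stf z) W s - x * gg (stf z) (W - x) (s - x ^ 2) - x ^ 2 * (kap s ^ 2 * stF z a)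
    = (a - b) * (stf z a - stf z b - stF z a * (a - b)) +
      x * (gg (stf z) (W - x) s - gg (stf z) (W - x) (s - x ^ 2)) := by
    rw [hab]
    unfold gg
    rw [← ha, ← hb]
    ring
  have hi : 0 ≤ x ^ 2 * (if |a - z| ≤ 2 * |x| then (1:ℝ) else 0) := by
    split_ifs <;> simp; positivity
  have h4 : |(a - b) * (stf z a - stf z b - stF z a * (a - b))| ≤
      16 * (x ^ 2 * (if |a - z| ≤ 2 * |x| then 1 else 0)) + 96 * |x| ^ 3
        + 32 * (|x| ^ 3 * |W - x|) := by
    rw [abs_mul]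
    by_cases hx : |x| ≤ 1
    · have h5 := stf_expand z a b
      have h6 : (if |a - z| ≤ |a - b| then (4:ℝ) else 0) ≤ 4 * (if |a - z| ≤ 2 * |x| then 1 else 0) := by
        by_cases h7 : |a - z| ≤ |a - b|
        · rw [if_pos h7, if_pos (h7.trans habs)]; norm_num
        · rw [if_neg h7]; split_ifs <;> norm_num
      have h7 : |a| ≤ 2 * (|W - x| + 1) := by
        rw [ha, abs_mul, abs_of_pos hk]
        have : |W| ≤ |W - x| + |x| := by
          have := abs_add_le (W - x) x
          rwa [sub_add_cancel] at this
        nlinarith [abs_nonneg W]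
      set I := (if |a - z| ≤ 2 * |x| then (1:ℝ) else 0)
      calc _ ≤ (2 * |x|) * ((2 * |x|) * ((2 * |x|) * (6 + 2 * (2 * (|W - x| + 1))) + 4 * I)) := by
            gcongr
            refine h5.trans ?_
            gcongr
        _ = 16 * (|x| ^ 2 * I) + 80 * |x| ^ 3 + 32 * (|x| ^ 3 * |W - x|) := by ring
        _ ≤ _ := by
          rw [sq_abs]
          have : 0 ≤ |x| ^ 3 := by positivity
          linarith
    · push Not at hx
      have h5 := stf_lip z a b
      have h6 : |stF z a * (a - b)| ≤ 2 * |a - b| := by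
        rw [abs_mul]; gcongr; exact stF_bound z a
      have h7 := abs_sub (stf z a - stf z b) (stF z a * (a - b))
      have h8 : |stf z a - stf z b - stF z a * (a - b)| ≤ 4 * (2 * |x|) := by linarith
      have h9 : 0 ≤ |x| ^ 3 * |W - x| := by positivity
      have h10 : |x| ^ 2 ≤ |x| ^ 3 := pow_le_pow_right₀ hx.le (by norm_num)
      calc _ ≤ (2 * |x|) * (4 * (2 * |x|)) := by gcongr
        _ = 16 * |x| ^ 2 := by ring
        _ ≤ _ := by
          have : 0 ≤ |x| ^ 3 := by positivity
          linarith
  rw [e]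
  refine (abs_add_le _ _).trans ?_
  linarith

def cTerm (X : ι → Ω → ℝ) (z : ℝ) (i : ι) (ω : Ω) : ℝ :=
  X i ω ^ 2 * (if |TT X ω - z| ≤ 2 * |X i ω| then 1 else 0)

lemma Setup.mTT (h : Setup P X L) : Measurable (TT X) :=
  (h.mW _).mul (measurable_kap.comp (h.mS _))

lemma Setup.cTerm_int (h : Setup P X L) (z : ℝ) (i : ι) : Integrable (cTerm X z i) P := by
  have hm : Measurable (fun ω => if |TT X ω - z| ≤ 2 * |X i ω| then (1:ℝ) else 0) :=
    Measurable.ite (measurableSet_le ((h.mTT.sub_const z).abs) ((h.meas i).abs.const_mul 2))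
      measurable_const measurable_const
  refine (h.int2 i).mul_bdd (c := 1) hm.aestronglyMeasurable (ae_of_all _ fun ω => ?_)
  split_ifs <;> simp

lemma Setup.cTerm_le (h : Setup P X L) (z : ℝ) (i : ι) :
    ∫ ω, cTerm X z i ω ∂P ≤ 96 * ∫ ω, |X i ω| ^ 3 ∂P + 656 * L * ∫ ω, X i ω ^ 2 ∂P := by
  have hL := h.pos
  have hi := Finset.notMem_erase i (Finset.univ : Finset ι)
  let F : ℝ → ℝ × ℝ → ℝ := fun x p =>
    x ^ 2 * (if |(p.1 + x) * kap (p.2 + x ^ 2) - z| ≤ 2 * |x| then 1 else 0)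
  have hF : Measurable (Function.uncurry F) := by
    have hk := measurable_kap
    refine Measurable.mul (by fun_prop) (Measurable.ite (measurableSet_le ?_ ?_) measurable_const measurable_const)
    · fun_prop
    · fun_prop
  have e : ∀ ω, cTerm X z i ω = F (X i ω) (WA X (Finset.univ.erase i) ω, SA X (Finset.univ.erase i) ω) := by
    intro ω
    simp only [cTerm, F, TT]
    rw [← WA_erase (Finset.mem_univ i), ← SA_erase (Finset.mem_univ i)]
    rw [sub_add_cancel, sub_add_cancel]
    congr 1
  have hKi : Integrable (fun ω => 96 * |X i ω| ^ 3 + 656 * L * X i ω ^ 2) P :=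
    ((h.int3 i).const_mul 96).add ((h.int2 i).const_mul _)
  have hFi := h.cTerm_int z i
  have e' : cTerm X z i = fun ω => F (X i ω) (WA X (Finset.univ.erase i) ω, SA X (Finset.univ.erase i) ω) :=
    funext e
  rw [e'] at hFi ⊢
  have key := h.condition hi hF (K := fun x => 96 * |x| ^ 3 + 656 * L * x ^ 2) (by fun_prop) hKi hFi ?_
  · refine key.trans (le_of_eq ?_)
    rw [integral_add ((h.int3 i).const_mul 96) ((h.int2 i).const_mul _), integral_const_mul,
      integral_const_mul]
  · intro x
    simp only [F]
    rw [integral_const_mul]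
    by_cases hx : |x| ≤ 1
    · have := h.conc (h.erase_var i) hx z (a := 2 * |x|) (by positivity)
      calc _ ≤ x ^ 2 * (48 * (2 * |x|) + 656 * L) := by gcongr
        _ = _ := by rw [← sq_abs x]; ring
    · push Not at hx
      have : ∫ ω, (if |(WA X (Finset.univ.erase i) ω + x) * kap (SA X (Finset.univ.erase i) ω + x ^ 2) - z|
          ≤ 2 * |x| then (1:ℝ) else 0) ∂P ≤ 1 := by
        have h0 : (∫ _ : Ω, (1:ℝ) ∂P) = 1 := by simp
        rw [← h0]
        refine integral_mono_of_nonneg (ae_of_all _ fun ω => ?_) (integrable_const 1) (ae_of_all _ fun ω => ?_)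
        · simp only [Pi.zero_apply]; split_ifs <;> norm_num
        · simp only; split_ifs <;> norm_num
      have h10 : |x| ^ 2 ≤ |x| ^ 3 := pow_le_pow_right₀ hx.le (by norm_num)
      rw [sq_abs] at h10
      have h11 : 0 ≤ |x| ^ 3 := by positivity
      have h12 : 0 ≤ 656 * L * x ^ 2 := by positivity
      nlinarith [sq_nonneg x]

lemma Setup.main_pw (h : Setup P X L) (z : ℝ) (ω : Ω) :
    |(if TT X ω ≤ z then (1:ℝ) else 0) - Φ z + ∑ i, X i ω * gg (stf z)
      (WA X (Finset.univ.erase i) ω) (SA X (Finset.univ.erase i) ω)| ≤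
    2 * Dv P X ω + ∑ i, (16 * cTerm X z i ω + 120 * |X i ω| ^ 3
        + 48 * (|X i ω| ^ 3 * |WA X (Finset.univ.erase i) ω|)) := by
  set W := WA X Finset.univ ω with hW
  set s := SA X Finset.univ ω with hs
  have hT : TT X ω = W * kap s := rfl
  have h1 : |∑ i, (X i ω * gg (stf z) W s - X i ω * gg (stf z)
      (WA X (Finset.univ.erase i) ω) (SA X (Finset.univ.erase i) ω)
      - X i ω ^ 2 * (kap s ^ 2 * stF z (W * kap s)))| ≤ ∑ i, (16 * cTerm X z i ω + 120 * |X i ω| ^ 3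
        + 48 * (|X i ω| ^ 3 * |WA X (Finset.univ.erase i) ω|)) := by
    refine (Finset.abs_sum_le_sum_abs _ _).trans (Finset.sum_le_sum fun i _ => ?_)
    have := stein_pt z W s (X i ω)
    rw [hW, hs, WA_erase (Finset.mem_univ i), SA_erase (Finset.mem_univ i)] at this
    exact this
  rw [Finset.sum_sub_distrib, Finset.sum_sub_distrib, ← Finset.sum_mul, ← Finset.sum_mul] at h1
  have eW : ∑ i, X i ω = W := rfl
  have eS : ∑ i, X i ω ^ 2 = s := rfl
  rw [eW, eS] at h1
  have h2 := (h.Dv_pt ω).1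
  rw [← hs] at h2
  have h3 : |(s * kap s ^ 2 - 1) * stF z (W * kap s)| ≤ 2 * Dv P X ω := by
    rw [abs_mul, mul_comm]
    exact mul_le_mul (stF_bound _ _) h2 (abs_nonneg _) (by norm_num)
  set G := ∑ i, X i ω * gg (stf z)
      (WA X (Finset.univ.erase i) ω) (SA X (Finset.univ.erase i) ω)
  have e : (if TT X ω ≤ z then (1:ℝ) else 0) - Φ z + G =
    -(W * gg (stf z) W s - G - s * (kap s ^ 2 * stF z (W * kap s)))
      - (s * kap s ^ 2 - 1) * stF z (W * kap s) := by
    have : (if TT X ω ≤ z then (1:ℝ) else 0) - Φ z = stF z (W * kap s) - W * gg (stf z) W s := by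
      unfold stF gg
      rw [hT]; ring
    rw [this]; ring
  rw [e]
  refine (abs_sub _ _).trans ?_
  rw [abs_neg]
  linarith

lemma Setup.main (h : Setup P X L) (z : ℝ) :
    |∫ ω, (if TT X ω ≤ z then (1:ℝ) else 0) ∂P - Φ z| ≤ 12210 * L := by
  have hm := measurable_gg (stf_cont z).measurable
  have i0 : Integrable (fun ω => if TT X ω ≤ z then (1:ℝ) else 0) P := by
    refine Integrable.of_bound (C := 1)
      (Measurable.ite (measurableSet_le h.mTT measurable_const) measurable_const
        measurable_const).aestronglyMeasurable (ae_of_all _ fun ω => ?_)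
    split_ifs <;> simp
  have i2 : ∀ j, Integrable (fun ω => X j ω * gg (stf z)
      (WA X (Finset.univ.erase j) ω) (SA X (Finset.univ.erase j) ω)) P := by
    intro j
    refine (h.int1 j).mul_bdd (c := 2 * 6)
      (hm.comp ((h.mW _).prodMk (h.mS _))).aestronglyMeasurable (ae_of_all _ fun ω => ?_)
    exact gg_bound (stf_bound z) _ _
  have i3 := fun j => h.int3W (Finset.notMem_erase j Finset.univ)
  have i4 : ∀ i, Integrable (fun ω => 16 * cTerm X z i ω + 120 * |X i ω| ^ 3
        + 48 * (|X i ω| ^ 3 * |WA X (Finset.univ.erase i) ω|)) P := fun i =>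
    (((h.cTerm_int z i).const_mul 16).add ((h.int3 i).const_mul 120)).add ((i3 i).const_mul 48)
  have i2s := integrable_finsetSum Finset.univ (fun j _ => i2 j)
  have i4s := integrable_finsetSum Finset.univ (fun j _ => i4 j)
  have z2 : ∑ j, ∫ ω, X j ω * gg (stf z)
      (WA X (Finset.univ.erase j) ω) (SA X (Finset.univ.erase j) ω) ∂P = 0 :=
    Finset.sum_eq_zero fun j _ => h.zero (Finset.notMem_erase j _) hm
  have e1 : ∫ ω, (if TT X ω ≤ z then (1:ℝ) else 0) ∂P - Φ z =
      ∫ ω, ((if TT X ω ≤ z then (1:ℝ) else 0) - Φ z + ∑ i, X i ω * gg (stf z)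
      (WA X (Finset.univ.erase i) ω) (SA X (Finset.univ.erase i) ω)) ∂P := by
    have i5 : Integrable (fun ω => (if TT X ω ≤ z then (1:ℝ) else 0) - Φ z) P :=
      i0.sub (integrable_const _)
    rw [integral_add i5 i2s, integral_sub i0 (integrable_const _),
      integral_finsetSum _ (fun j _ => i2 j), z2]
    simp
  rw [e1]
  refine (abs_integral_le_integral_abs).trans ?_
  refine (integral_mono ((i0.sub (integrable_const _)).add i2s).abs
    ((h.Dv_int.const_mul 2).add i4s) (h.main_pw z)).trans ?_
  rw [integral_add' (h.Dv_int.const_mul 2) i4s, integral_const_mul,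
    integral_finsetSum _ (fun j _ => i4 j)]
  have h5 := h.Dv_le
  have h6 : ∑ i, ∫ ω, (16 * cTerm X z i ω + 120 * |X i ω| ^ 3
        + 48 * (|X i ω| ^ 3 * |WA X (Finset.univ.erase i) ω|)) ∂P ≤
      ∑ i, (1704 * ∫ ω, |X i ω| ^ 3 ∂P + 10496 * L * ∫ ω, X i ω ^ 2 ∂P) := by
    refine Finset.sum_le_sum fun i _ => ?_
    have i6 : Integrable (fun ω => 16 * cTerm X z i ω + 120 * |X i ω| ^ 3) P :=
      ((h.cTerm_int z i).const_mul 16).add ((h.int3 i).const_mul 120)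
    rw [integral_add i6 ((i3 i).const_mul 48),
      integral_add ((h.cTerm_int z i).const_mul 16) ((h.int3 i).const_mul 120),
      integral_const_mul, integral_const_mul, integral_const_mul]
    have h7 := h.cTerm_le z i
    have h8 := h.le3W (Finset.notMem_erase i Finset.univ)
    linarith
  rw [Finset.sum_add_distrib, ← Finset.mul_sum, ← Finset.mul_sum, h.hL, h.var1] at h6
  linarith

end prob

/-! ### From the self-normalised sum to the studentized statistic -/

lemma gI_sub_le {x y : ℝ} (hx : 0 ≤ x) (hxy : x ≤ y) :
    gI y - gI x ≤ (y - x) * Real.exp (-x ^ 2 / 2) := by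
  rcases hxy.eq_or_lt with rfl | hlt
  · simp
  obtain ⟨c, hc, e⟩ := exists_deriv_eq_slope' gI hlt
    (fun t _ => (gI_hasDeriv t).continuousAt.continuousWithinAt)
    (fun t _ => (gI_hasDeriv t).differentiableAt.differentiableWithinAt)
  rw [(gI_hasDeriv c).deriv, slope_def_field, eq_div_iff (by linarith)] at e
  rw [← e, mul_comm]
  refine mul_le_mul_of_nonneg_left (Real.exp_le_exp.2 ?_) (by linarith)
  have := hc.1
  nlinarith

lemma sq_mul_exp (x : ℝ) : x ^ 2 * Real.exp (-x ^ 2 / 2) ≤ 2 := by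
  have h := Real.add_one_le_exp (x ^ 2 / 2)
  have h2 := exp_half_mul x
  have h3 := Real.exp_pos (-x ^ 2 / 2)
  nlinarith

lemma gI_shift {s z : ℝ} (hs : 0 < s) (hz : 0 ≤ z) :
    |gI z - gI (z / Real.sqrt (1 + z ^ 2 / s ^ 2))| ≤ 2 / s := by
  set r := Real.sqrt (1 + z ^ 2 / s ^ 2) with hr
  have hr2 : r ^ 2 = 1 + z ^ 2 / s ^ 2 := Real.sq_sqrt (by positivity)
  have hr1 : 1 ≤ r := Real.one_le_sqrt.2 (by have : 0 ≤ z ^ 2 / s ^ 2 := by positivity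
                                             linarith)
  have hr2' : r ^ 2 * s ^ 2 = s ^ 2 + z ^ 2 := by
    rw [hr2]; field_simp
  have hr0 : 0 < r := by linarith
  set w := z / r with hw
  have hw0 : 0 ≤ w := by positivity
  have hwr : w * r = z := by rw [hw]; field_simp
  have hwz : w ≤ z := div_le_self hz hr1
  have hmono := gI_mono hwz
  rw [abs_of_nonneg (by linarith)]
  rw [le_div_iff₀ hs]
  by_cases hc : z ≤ s
  · have h1 := gI_sub_le hw0 hwz
    have h2 := sq_mul_exp w
    have hE := Real.exp_pos (-w ^ 2 / 2)
    -- r - 1 ≤ (r^2-1)/2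
    have h3 : (z - w) * s ≤ w ^ 2 := by
      have h4 : r ^ 2 ≤ 2 := by
        have : z ^ 2 / s ^ 2 ≤ 1 := by
          rw [div_le_one (by positivity)]
          nlinarith
        linarith
      have h5 : (r - 1) * s ^ 2 ≤ w ^ 2 := by
        have h6 : (r ^ 2 - 1) * s ^ 2 = w ^ 2 * r ^ 2 := by
          rw [← mul_pow, hwr]; linarith
        have h7 : r - 1 ≤ (r ^ 2 - 1) / 2 := by nlinarith
        have h8 : (r - 1) * s ^ 2 ≤ (r ^ 2 - 1) / 2 * s ^ 2 :=
          mul_le_mul_of_nonneg_right h7 (by positivity)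
        nlinarith [sq_nonneg w]
      have h9 : z - w = w * (r - 1) := by rw [mul_sub, hwr]; ring
      have h10 : w ≤ s := hwz.trans hc
      rw [h9]
      have h11 : w * (r - 1) * s ≤ s * (r - 1) * s := by
        have : 0 ≤ r - 1 := by linarith
        gcongr
      nlinarith
    have h12 : (z - w) * s * Real.exp (-w ^ 2 / 2) ≤ w ^ 2 * Real.exp (-w ^ 2 / 2) :=
      mul_le_mul_of_nonneg_right h3 hE.le
    nlinarith
  · push Not at hc
    have hwp : 0 < w := by
      rw [hw]; exact div_pos (by linarith) hr0
    have h1 := gJ_tail hwp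
    have h2 : Real.exp (-w ^ 2 / 2) ≤ 1 := Real.exp_le_one_iff.2 (by nlinarith [sq_nonneg w])
    have h3 : gI z - gI w ≤ gJ w := by
      have := gI_add_gJ z
      have := gI_add_gJ w
      have := gJ_nonneg z
      linarith
    have h4 : s ≤ 2 * w := by
      refine le_of_sq_le_sq ?_ (by positivity)
      have : r ^ 2 * s ^ 2 ≤ r ^ 2 * (2 * w) ^ 2 := by
        have : r ^ 2 * (2 * w) ^ 2 = 4 * z ^ 2 := by rw [← hwr]; ring
        nlinarith
      exact le_of_mul_le_mul_left this (by positivity)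
    have h5 := gJ_nonneg w
    nlinarith

lemma Phi_shift {s : ℝ} (hs : 0 < s) (z : ℝ) :
    |Φ z - Φ (z / Real.sqrt (1 + z ^ 2 / s ^ 2))| ≤ 2 / s := by
  have key : |gI z - gI (z / Real.sqrt (1 + z ^ 2 / s ^ 2))| ≤ 2 / s := by
    rcases le_total 0 z with hz | hz
    · exact gI_shift hs hz
    · have h := gI_shift hs (z := -z) (by linarith)
      rw [neg_sq, neg_div] at h
      have e1 := gI_neg (-z)
      have e2 := gI_neg (-(z / Real.sqrt (1 + z ^ 2 / s ^ 2)))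
      have e3 := gI_add_gJ (-z)
      have e4 := gI_add_gJ (-(z / Real.sqrt (1 + z ^ 2 / s ^ 2)))
      rw [neg_neg] at e1 e2
      rw [e1, e2, abs_sub_comm]
      convert h using 2
      linarith
  rw [Phi_eq, Phi_eq, ← sub_div, abs_div, abs_of_pos gc_pos]
  exact (div_le_self (abs_nonneg _) gc_ge).trans key

lemma cmp_aux {W z p q r : ℝ} (hp : 0 < p) (hq : 0 < q) (hr : 0 < r)
    (h : W ^ 2 - z ^ 2 * p ^ 2 = W ^ 2 * r ^ 2 - z ^ 2 * q ^ 2) :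
    W ≤ z * p ↔ W * r ≤ z * q := by
  rcases le_or_gt 0 z with hz | hz
  · rcases le_or_gt W 0 with hW | hW
    · exact ⟨fun _ => (mul_nonpos_of_nonpos_of_nonneg hW hr.le).trans (by positivity),
        fun _ => hW.trans (by positivity)⟩
    · rw [← sq_le_sq₀ hW.le (by positivity), ← sq_le_sq₀ (by positivity : 0 ≤ W * r) (by positivity),
        mul_pow, mul_pow, mul_pow]
      constructor <;> intro _ <;> linarith
  · rcases le_or_gt 0 W with hW | hW
    · have h1 : z * p < 0 := mul_neg_of_neg_of_pos hz hp
      have h2 : z * q < 0 := mul_neg_of_neg_of_pos hz hq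
      have h3 : 0 ≤ W * r := by positivity
      constructor <;> intro _ <;> linarith
    · have hz' : 0 < -z := by linarith
      have hW' : 0 < -W := by linarith
      rw [← neg_le_neg_iff, ← neg_mul, ← neg_le_neg_iff (a := z * q), ← neg_mul, ← neg_mul,
        ← sq_le_sq₀ (by positivity) hW'.le,
        ← sq_le_sq₀ (by positivity : 0 ≤ -z * q) (by positivity),
        mul_pow, mul_pow, mul_pow, neg_sq, neg_sq]
      constructor <;> intro _ <;> linarith

lemma studentized_eq {m : ℕ} (hm : 0 < m) {c : ℝ} (hc : 0 < c) (x : Fin m → ℝ) {W S : ℝ}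
    (hW : ∑ i, x i = W) (hS : ∑ i, x i ^ 2 = S) (hD : 0 < S - W ^ 2 / m) :
    studentized m (fun i => c * x i) = W / Real.sqrt (S - W ^ 2 / m) := by
  have hm' : (0:ℝ) < m := by exact_mod_cast hm
  have e1 : ∑ i, c * x i = c * W := by rw [← Finset.mul_sum, hW]
  have e2 : (∑ i, (c * x i - c * W / m) ^ 2) / m = c ^ 2 * (S - W ^ 2 / m) / m := by
    have : ∀ i, (c * x i - c * W / m) ^ 2 =
        c ^ 2 * x i ^ 2 - (2 * c ^ 2 * W / m) * x i + c ^ 2 * W ^ 2 / m ^ 2 := by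
      intro i; field_simp; ring
    simp_rw [this]
    rw [Finset.sum_add_distrib, Finset.sum_sub_distrib, ← Finset.mul_sum, ← Finset.mul_sum, hW, hS]
    simp
    field_simp
    ring
  unfold studentized
  rw [e1, e2, Real.sqrt_div (by positivity), Real.sqrt_mul (by positivity), Real.sqrt_sq hc.le]
  have h1 : 0 < Real.sqrt (S - W ^ 2 / m) := Real.sqrt_pos.2 hD
  have h2 : 0 < Real.sqrt m := Real.sqrt_pos.2 hm'
  have h3 : Real.sqrt m ^ 2 = m := Real.sq_sqrt hm'.le
  field_simp
  rw [h3]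
  ring

lemma Setup.final_pt {Ω : Type*} [MeasurableSpace Ω] {P : Measure Ω} [IsProbabilityMeasure P]
    {m : ℕ} {X : Fin m → Ω → ℝ} {L : ℝ}
    (h : Setup P X L) (hm : 0 < m) {c : ℝ} (hc : 0 < c) (z : ℝ) (ω : Ω) :
    |(if studentized m (fun i => c * X i ω) ≤ z then (1:ℝ) else 0) -
      (if TT X ω ≤ z / Real.sqrt (1 + z ^ 2 / Real.sqrt m ^ 2) then (1:ℝ) else 0)| ≤
      Dv P X ω + 4 / m * WA X Finset.univ ω ^ 2 := by
  have hm' : (0:ℝ) < m := by exact_mod_cast hm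
  have h3 : Real.sqrt m ^ 2 = m := Real.sq_sqrt hm'.le
  have hD := (h.Dv_pt ω).2
  have hD0 : 0 ≤ Dv P X ω := (abs_nonneg _).trans (h.Dv_pt ω).1
  have hone : ∀ (p q : Prop) [Decidable p] [Decidable q],
      |(if p then (1:ℝ) else 0) - (if q then (1:ℝ) else 0)| ≤ 1 := by
    intro p q _ _
    split_ifs <;> norm_num
  have hW0 : 0 ≤ 4 / m * WA X Finset.univ ω ^ 2 := by positivity
  by_cases hS : 1 / 4 ≤ SA X Finset.univ ω ∧ SA X Finset.univ ω ≤ 4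
  · set W := WA X Finset.univ ω with hWd
    set S := SA X Finset.univ ω with hSd
    by_cases hpos : 0 < S - W ^ 2 / m
    · have hS0 : 0 < S := by linarith [hS.1]
      have hiff : studentized m (fun i => c * X i ω) ≤ z ↔
          TT X ω ≤ z / Real.sqrt (1 + z ^ 2 / Real.sqrt m ^ 2) := by
        rw [studentized_eq hm hc (fun i => X i ω) (W := W) (S := S) rfl rfl hpos,
          div_le_iff₀ (Real.sqrt_pos.2 hpos)]
        have hr : 0 < Real.sqrt (1 + z ^ 2 / Real.sqrt m ^ 2) := Real.sqrt_pos.2 (by positivity)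
        have hk : kap S = (Real.sqrt S)⁻¹ := by
          unfold kap clp
          rw [min_eq_right hS.2, max_eq_right hS.1]
        have hT : TT X ω = W / Real.sqrt S := by
          unfold TT
          rw [← hSd, ← hWd, hk, div_eq_mul_inv]
        rw [hT, div_le_div_iff₀ (Real.sqrt_pos.2 hS0) hr]
        refine cmp_aux (Real.sqrt_pos.2 hpos) (Real.sqrt_pos.2 hS0) hr ?_
        rw [Real.sq_sqrt hpos.le, Real.sq_sqrt hS0.le, Real.sq_sqrt (by positivity), h3]
        field_simp
        ring
      have : (if studentized m (fun i => c * X i ω) ≤ z then (1:ℝ) else 0) =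
        (if TT X ω ≤ z / Real.sqrt (1 + z ^ 2 / Real.sqrt m ^ 2) then (1:ℝ) else 0) :=
        if_congr hiff rfl rfl
      rw [this, sub_self, abs_zero]
      linarith
    · push Not at hpos
      have : 4 / m * W ^ 2 = 4 * (W ^ 2 / m) := by ring
      have := hone (studentized m (fun i => c * X i ω) ≤ z)
        (TT X ω ≤ z / Real.sqrt (1 + z ^ 2 / Real.sqrt m ^ 2))
      linarith [hS.1]
  · rw [if_neg hS] at hD
    have := hone (studentized m (fun i => c * X i ω) ≤ z)
        (TT X ω ≤ z / Real.sqrt (1 + z ^ 2 / Real.sqrt m ^ 2))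
    linarith

lemma measurable_studentized (m : ℕ) : Measurable (studentized m) := by
  unfold studentized
  fun_prop

lemma Setup.final {Ω : Type*} [MeasurableSpace Ω] {P : Measure Ω} [IsProbabilityMeasure P]
    {m : ℕ} {X : Fin m → Ω → ℝ} {L : ℝ}
    (h : Setup P X L) (hm : 0 < m) {c : ℝ} (hc : 0 < c) (z : ℝ) (hmL : 1 / Real.sqrt m ≤ L) :
    |∫ ω, (if studentized m (fun i => c * X i ω) ≤ z then (1:ℝ) else 0) ∂P - Φ z| ≤ 12300 * L := by
  have hm' : (0:ℝ) < m := by exact_mod_cast hm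
  have hsm : 1 ≤ Real.sqrt m := Real.one_le_sqrt.2 (by exact_mod_cast hm)
  have h3 : Real.sqrt m ^ 2 = m := Real.sq_sqrt hm'.le
  set z' := z / Real.sqrt (1 + z ^ 2 / Real.sqrt m ^ 2) with hz'
  have hst : Measurable (fun ω => studentized m (fun i => c * X i ω)) := by
    have := h.meas
    exact (measurable_studentized m).comp (by fun_prop)
  have i1 : Integrable (fun ω => if studentized m (fun i => c * X i ω) ≤ z then (1:ℝ) else 0) P := by
    refine Integrable.of_bound (C := 1)
      (Measurable.ite (measurableSet_le hst measurable_const) measurable_const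
        measurable_const).aestronglyMeasurable (ae_of_all _ fun ω => ?_)
    split_ifs <;> simp
  have i2 : Integrable (fun ω => if TT X ω ≤ z' then (1:ℝ) else 0) P := by
    refine Integrable.of_bound (C := 1)
      (Measurable.ite (measurableSet_le h.mTT measurable_const) measurable_const
        measurable_const).aestronglyMeasurable (ae_of_all _ fun ω => ?_)
    split_ifs <;> simp
  have i3 : Integrable (fun ω => WA X Finset.univ ω ^ 2) P := (h.memLpW _).integrable_sq
  have k1 : |∫ ω, (if studentized m (fun i => c * X i ω) ≤ z then (1:ℝ) else 0) ∂P
      - ∫ ω, (if TT X ω ≤ z' then (1:ℝ) else 0) ∂P| ≤ 9 * L := by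
    rw [← integral_sub i1 i2]
    refine abs_integral_le_integral_abs.trans ?_
    refine (integral_mono (i1.sub i2).abs (h.Dv_int.add (i3.const_mul (4 / m)))
      (h.final_pt hm hc z)).trans ?_
    rw [integral_add' h.Dv_int (i3.const_mul (4 / m)), integral_const_mul]
    have h4 := h.Dv_le
    have h5 := h.W2 Finset.univ
    have h6 : 4 / m * ∫ ω, WA X Finset.univ ω ^ 2 ∂P ≤ 4 / m * 1 :=
      mul_le_mul_of_nonneg_left h5 (by positivity)
    have h7 : (1:ℝ) / m ≤ 1 / Real.sqrt m := by
      apply one_div_le_one_div_of_le (by linarith)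
      nlinarith
    have h8 : (4:ℝ) / m = 4 * (1 / m) := by ring
    linarith
  have k2 := h.main z'
  have k3 := Phi_shift (s := Real.sqrt m) (by linarith) z
  rw [← hz'] at k3
  have k4 : 2 / Real.sqrt m = 2 * (1 / Real.sqrt m) := by ring
  rw [abs_le] at k1 k2 k3 ⊢
  constructor <;> linarith [k1.1, k1.2, k2.1, k2.2, k3.1, k3.2, h.pos]

lemma measurable_dot {d : ℕ} (v : Fin d → ℝ) : Measurable (dot v) := by
  unfold dot
  fun_prop

theorem cross_mean_conditional_berry_esseen :
    ∃ C : ℝ, 0 < C ∧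
      ∀ (d m₁ : ℕ), 0 < m₁ →
        ∀ P : Measure (Fin d → ℝ), IsProbabilityMeasure P →
          (∀ i, Integrable (fun x => x i) P) →
          (∀ i, ∫ x, x i ∂P = 0) →
          ∀ v : Fin d → ℝ,
            Integrable (fun x => |dot v x| ^ 3) P →
            Integrable (fun x => dot v x ^ 2) P →
            0 < ∫ x, dot v x ^ 2 ∂P →
            ∀ z : ℝ,
              |((Measure.pi fun _ : Fin m₁ => P)
                  {ω | studentized m₁ (fun i => dot v (ω i)) ≤ z}).toReal - Φ z| ≤
                C * (∫ x, |dot v x| ^ 3 ∂P) /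
                  ((∫ x, dot v x ^ 2 ∂P) ^ ((3 : ℝ) / 2) * Real.sqrt m₁) := by
  refine ⟨12300, by norm_num, ?_⟩
  intro d m hm P hP hint hmean v h3 h2 hpos z
  have hm' : (0:ℝ) < m := by exact_mod_cast hm
  have hsm : 0 < Real.sqrt m := Real.sqrt_pos.2 hm'
  have hsm2 : Real.sqrt m ^ 2 = m := Real.sq_sqrt hm'.le
  set V := ∫ x, dot v x ^ 2 ∂P with hV
  set β := ∫ x, |dot v x| ^ 3 ∂P with hβ
  set σ := Real.sqrt V with hσ
  have hσ0 : 0 < σ := Real.sqrt_pos.2 hpos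
  have hσ2 : σ ^ 2 = V := Real.sq_sqrt hpos.le
  have eV : V ^ ((3:ℝ) / 2) = σ ^ 3 := by
    rw [hσ, Real.sqrt_eq_rpow, ← Real.rpow_natCast, ← Real.rpow_mul hpos.le]
    norm_num
  rw [eV]
  have hdm := measurable_dot v
  have hbig : σ ^ 3 ≤ β := by
    have i1 : Integrable (fun x => 2 / 3 * |dot v x| ^ 3 + σ ^ 3 / 3) P :=
      (h3.const_mul _).add (integrable_const _)
    have h := integral_mono (h2.const_mul σ) i1 (fun x => by
      have ha := abs_nonneg (dot v x)
      simp only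
      rw [← sq_abs (dot v x)]
      nlinarith [mul_nonneg (by positivity : 0 ≤ 2 * |dot v x| + σ) (sq_nonneg (|dot v x| - σ))])
    rw [integral_const_mul, integral_add (h3.const_mul _) (integrable_const _),
      integral_const_mul, integral_const] at h
    simp only [probReal_univ, one_smul] at h
    rw [← hV, ← hβ, ← hσ2] at h
    nlinarith
  have hβ0 : 0 < β := lt_of_lt_of_le (by positivity) hbig
  set L := β / (σ ^ 3 * Real.sqrt m) with hLd
  have hL0 : 0 < L := by positivity
  rw [mul_div_assoc, ← hLd]
  set Q := (Measure.pi fun _ : Fin m => P) with hQ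
  have hp1 : (Q {ω | studentized m (fun i => dot v (ω i)) ≤ z}).toReal ≤ 1 := measureReal_le_one
  have hp0 : 0 ≤ (Q {ω | studentized m (fun i => dot v (ω i)) ≤ z}).toReal := ENNReal.toReal_nonneg
  by_cases hsmall : L ≤ 1 / 24
  swap
  · push Not at hsmall
    have := Phi_nonneg z
    have := Phi_le_one z
    rw [abs_le]
    constructor <;> linarith
  set c := σ * Real.sqrt m with hc
  have hc0 : 0 < c := by positivity
  let X : Fin m → (Fin m → Fin d → ℝ) → ℝ := fun i ω => dot v (ω i) / c
  have hev : ∀ (i : Fin m) (g : (Fin d → ℝ) → ℝ), Measurable g →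
      ∫ ω, g (ω i) ∂Q = ∫ x, g x ∂P := by
    intro i g hg
    have hmp := measurePreserving_eval (fun _ : Fin m => P) i
    have := integral_map (μ := Q) (φ := Function.eval i) (f := g) hmp.measurable.aemeasurable
      hg.aestronglyMeasurable
    rw [hmp.map_eq] at this
    exact this.symm
  have hint' : ∀ (i : Fin m) (g : (Fin d → ℝ) → ℝ), Integrable g P →
      Integrable (fun ω => g (ω i)) Q := by
    intro i g hg
    exact (measurePreserving_eval (fun _ : Fin m => P) i).integrable_comp_of_integrable hg
  have e3 : ∀ (i : Fin m) ω, |X i ω| ^ 3 = (c ^ 3)⁻¹ * |dot v (ω i)| ^ 3 := by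
    intro i ω
    simp only [X]
    rw [abs_div, abs_of_pos hc0, div_pow]; ring
  have e2 : ∀ (i : Fin m) ω, X i ω ^ 2 = (c ^ 2)⁻¹ * dot v (ω i) ^ 2 := by
    intro i ω
    simp only [X]
    rw [div_pow]; ring
  have hset : Setup Q X L := by
    refine ⟨?_, ?_, ?_, ?_, ?_, ?_, hL0, hsmall⟩
    · intro i
      exact (hdm.comp (measurable_pi_apply i)).div_const c
    · exact iIndepFun_pi (μ := fun _ : Fin m => P) (X := fun _ x => dot v x / c)
        (fun i => (hdm.div_const c).aemeasurable)
    · intro i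
      simp_rw [e3]
      exact (hint' i _ h3).const_mul _
    · intro i
      have : ∫ ω, X i ω ∂Q = ∫ x, dot v x / c ∂P := hev i (fun x => dot v x / c) (hdm.div_const c)
      rw [this, integral_div]
      have : ∫ x, dot v x ∂P = 0 := by
        unfold dot
        rw [integral_finsetSum _ (fun i _ => (hint i).const_mul _)]
        refine Finset.sum_eq_zero fun i _ => ?_
        rw [integral_const_mul, hmean, mul_zero]
      rw [this, zero_div]
    · simp_rw [e2, integral_const_mul]
      have : ∀ i : Fin m, ∫ ω, dot v (ω i) ^ 2 ∂Q = V := fun i =>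
        hev i (fun x => dot v x ^ 2) (hdm.pow_const 2)
      simp_rw [this]
      simp only [Finset.sum_const, Finset.card_univ, Fintype.card_fin, nsmul_eq_mul]
      rw [hc, mul_pow, hsm2, hσ2]
      field_simp
    · simp_rw [e3, integral_const_mul]
      have : ∀ i : Fin m, ∫ ω, |dot v (ω i)| ^ 3 ∂Q = β := fun i =>
        hev i (fun x => |dot v x| ^ 3) (hdm.abs.pow_const 3)
      simp_rw [this]
      simp only [Finset.sum_const, Finset.card_univ, Fintype.card_fin, nsmul_eq_mul]
      rw [hc, hLd]
      have hq : (m:ℝ) * ((σ * Real.sqrt m) ^ 3)⁻¹ * β =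
          Real.sqrt m ^ 2 * ((σ * Real.sqrt m) ^ 3)⁻¹ * β := by rw [hsm2]
      rw [← mul_assoc, hq]
      field_simp
  have hmL : 1 / Real.sqrt m ≤ L := by
    rw [hLd, div_le_div_iff₀ hsm (by positivity)]
    nlinarith
  have key := hset.final hm hc0 z hmL
  have e : ∀ ω : Fin m → Fin d → ℝ, (fun i => c * X i ω) = fun i => dot v (ω i) := by
    intro ω
    funext i
    simp only [X]
    field_simp
  simp_rw [e] at key
  have hms : MeasurableSet {ω : Fin m → Fin d → ℝ | studentized m (fun i => dot v (ω i)) ≤ z} := by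
    refine measurableSet_le ((measurable_studentized m).comp ?_) measurable_const
    exact measurable_pi_lambda _ fun i => hdm.comp (measurable_pi_apply i)
  have hI := integral_indicator_one (μ := Q) hms
  have hI' : ∫ ω, (if studentized m (fun i => dot v (ω i)) ≤ z then (1:ℝ) else 0) ∂Q
      = (Q {ω | studentized m (fun i => dot v (ω i)) ≤ z}).toReal := by
    rw [← measureReal_def, ← hI]
    refine integral_congr_ae (ae_of_all _ fun ω => ?_)
    simp [Set.indicator_apply]
  rw [hI'] at key
  exact key

end
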